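/- arXiv:2605.07107 — 2 statements merged into one kernel-verified Lean document; each statement's English description precedes it below -/
import Mathlib

section
/- Under Assumptions 1 and 2, for every ε > 0 there exist constants C > 0 and c > 0 such that for every n ≥ 1, the probability (under the i.i.d. sampling from f(·|θ₀)) that |θ̂_n − θ₀| ≥ ε is at most C·exp(−c·n). -/
open MeasureTheory ProbabilityTheory Filter Real Set

/-- A real random variable has sub-Gaussian tails. -/
def SubGaussianTail {Ω : Type*} [MeasurableSpace Ω] (P : Measure Ω) (W : Ω → ℝ) : Prop :=
  ∃ C > 0, ∃ c > 0, ∀ t > 0,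
    P {ω | t ≤ |W ω|} ≤ ENNReal.ofReal (C * Real.exp (-c * t ^ 2))

/-- A real random variable has sub-exponential tails. -/
def SubExponentialTail {Ω : Type*} [MeasurableSpace Ω] (P : Measure Ω) (W : Ω → ℝ) : Prop :=
  ∃ C > 0, ∃ c > 0, ∀ t > 0,
    P {ω | t ≤ |W ω|} ≤ ENNReal.ofReal (C * Real.exp (-c * t))

/-- Exponential moments from sub-Gaussian tails. -/
lemma integrable_exp_of_tail {Ω : Type*} [MeasurableSpace Ω] (P : Measure Ω)
    [IsProbabilityMeasure P] (W : Ω → ℝ) (hW : Measurable W) (hW0 : ∀ ω, 0 ≤ W ω)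
    (h : SubGaussianTail P W) (l : ℝ) (hl : 0 ≤ l) :
    Integrable (fun ω => Real.exp (l * W ω)) P := by
  obtain ⟨C, hC, c, hc, ht⟩ := h
  refine ⟨by fun_prop, ?_⟩
  rw [hasFiniteIntegral_iff_ofReal (ae_of_all _ fun ω => (Real.exp_pos _).le)]
  -- a bound of the tail
  set D : ℝ := 1 + C * Real.exp ((l + 1) ^ 2 / (4 * c)) with hD
  have hD0 : 0 < D := by positivity
  have htail : ∀ k : ℕ, P {ω | (k : ℝ) ≤ W ω} ≤ ENNReal.ofReal (D * Real.exp (-(l + 1) * k)) := by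
    intro k
    rcases Nat.eq_zero_or_pos k with rfl | hk
    · refine prob_le_one.trans ?_
      rw [← ENNReal.ofReal_one]
      apply ENNReal.ofReal_le_ofReal
      simp [hD]
      positivity
    · have hk' : (0 : ℝ) < k := by exact_mod_cast hk
      have h1 := ht k hk'
      refine le_trans (measure_mono ?_) (h1.trans (ENNReal.ofReal_le_ofReal ?_))
      · intro ω hω
        have hω' : (k : ℝ) ≤ W ω := hω
        exact hω'.trans (le_abs_self _)
      · have : Real.exp (-c * (k : ℝ) ^ 2)
            ≤ Real.exp ((l + 1) ^ 2 / (4 * c)) * Real.exp (-(l + 1) * k) := by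
          rw [← Real.exp_add]
          apply Real.exp_le_exp.2
          have h2 : 0 ≤ (2 * c * k - (l + 1)) ^ 2 / (4 * c) := by positivity
          have h3 : (2 * c * k - (l + 1)) ^ 2 / (4 * c)
              = c * (k : ℝ) ^ 2 - (l + 1) * k + (l + 1) ^ 2 / (4 * c) := by
            field_simp
            ring
          linarith
        have h4 := Real.exp_pos (-(l + 1) * (k : ℝ))
        calc C * Real.exp (-c * (k : ℝ) ^ 2)
            ≤ C * (Real.exp ((l + 1) ^ 2 / (4 * c)) * Real.exp (-(l + 1) * k)) := by gcongr
          _ ≤ D * Real.exp (-(l + 1) * k) := by rw [hD]; nlinarith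
  have hms : ∀ k : ℕ, MeasurableSet {ω | (k : ℝ) ≤ W ω} := fun k =>
    measurableSet_le measurable_const hW
  have hpt : ∀ ω, ENNReal.ofReal (Real.exp (l * W ω)) ≤
      ∑' k : ℕ, ({ω | (k : ℝ) ≤ W ω}).indicator
        (fun _ => ENNReal.ofReal (Real.exp (l * (k + 1)))) ω := by
    intro ω
    refine le_trans ?_ (ENNReal.le_tsum ⌊W ω⌋₊)
    rw [Set.indicator_of_mem (by exact Nat.floor_le (hW0 ω))]
    apply ENNReal.ofReal_le_ofReal
    apply Real.exp_le_exp.2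
    have := (Nat.lt_floor_add_one (W ω)).le
    gcongr
  refine lt_of_le_of_lt (lintegral_mono hpt) ?_
  rw [lintegral_tsum (fun k => (measurable_const.indicator (hms k)).aemeasurable)]
  have hterm : ∀ k : ℕ, ∫⁻ ω, ({ω | (k : ℝ) ≤ W ω}).indicator
        (fun _ => ENNReal.ofReal (Real.exp (l * (k + 1)))) ω ∂P
        ≤ ENNReal.ofReal (D * Real.exp l * Real.exp (-1) ^ k) := by
    intro k
    rw [lintegral_indicator_const (hms k)]
    refine (mul_le_mul_right (htail k) _).trans ?_
    rw [← ENNReal.ofReal_mul (Real.exp_pos _).le]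
    apply ENNReal.ofReal_le_ofReal
    rw [← Real.exp_nat_mul, mul_assoc, ← Real.exp_add, mul_left_comm, ← Real.exp_add]
    apply le_of_eq
    congr 2
    ring
  refine lt_of_le_of_lt (ENNReal.tsum_le_tsum hterm) ?_
  have hsum : Summable (fun k : ℕ => D * Real.exp l * Real.exp (-1) ^ k) :=
    (summable_geometric_of_lt_one (Real.exp_pos _).le (by simp)).mul_left _
  rw [← ENNReal.ofReal_tsum_of_nonneg (fun k => by positivity) hsum]
  exact ENNReal.ofReal_lt_top

/-- A measurable Lipschitz envelope. -/
lemma exists_measurable_envelope {𝓧 : Type*} [MeasurableSpace 𝓧] (K : Set ℝ) (hne : K.Nonempty)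
    (g : ℝ → 𝓧 → ℝ) (hg : ∀ θ ∈ K, Measurable (g θ))
    (H : 𝓧 → ℝ) (hH0 : ∀ x, 0 ≤ H x)
    (hH : ∀ x, ∀ θ ∈ K, ∀ θ' ∈ K, |g θ x - g θ' x| ≤ H x * |θ - θ'|) :
    ∃ G : 𝓧 → ℝ, Measurable G ∧ (∀ x, 0 ≤ G x) ∧ (∀ x, G x ≤ H x) ∧
      ∀ x, ∀ θ ∈ K, ∀ θ' ∈ K, |g θ x - g θ' x| ≤ G x * |θ - θ'| := by
  have : Nonempty K := hne.to_subtype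
  let u := TopologicalSpace.denseSeq K
  let E : 𝓧 → ENNReal := fun x => ⨆ p : ℕ × ℕ,
    ENNReal.ofReal (|g (u p.1) x - g (u p.2) x| / |(u p.1 : ℝ) - u p.2|)
  have hEH : ∀ x, E x ≤ ENNReal.ofReal (H x) := by
    intro x
    refine iSup_le fun p => ENNReal.ofReal_le_ofReal ?_
    exact div_le_of_le_mul₀ (abs_nonneg _) (hH0 x) (hH x _ (u p.1).2 _ (u p.2).2)
  refine ⟨fun x => (E x).toReal, ?_, fun x => ENNReal.toReal_nonneg, ?_, ?_⟩
  · apply Measurable.ennreal_toReal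
    refine Measurable.iSup fun p => ?_
    have h1 := hg _ (u p.1).2
    have h2 := hg _ (u p.2).2
    have h3 : Measurable (fun x => |g (u p.1) x - g (u p.2) x|) := (h1.sub h2).abs
    exact (h3.div_const _).ennreal_ofReal
  · intro x
    exact ENNReal.toReal_le_of_le_ofReal (hH0 x) (hEH x)
  · intro x
    have hcont : Continuous (fun t : K => g t x) := by
      have : LipschitzWith (H x).toNNReal (fun t : K => g t x) := by
        apply LipschitzWith.of_dist_le_mul
        intro a b
        rw [Real.coe_toNNReal _ (hH0 x)]
        exact hH x a a.2 b b.2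
      exact this.continuous
    have key : ∀ a b : K, |g a x - g b x| ≤ (E x).toReal * |(a : ℝ) - b| := by
      intro a b
      refine DenseRange.induction_on₂ (TopologicalSpace.denseRange_denseSeq K)
        (p := fun a b : K => |g a x - g b x| ≤ (E x).toReal * |(a : ℝ) - b|) ?_ ?_ a b
      · apply isClosed_le
        · exact ((hcont.comp continuous_fst).sub (hcont.comp continuous_snd)).abs
        · fun_prop
      · intro i j
        change |g (u i) x - g (u j) x| ≤ (E x).toReal * |(u i : ℝ) - u j|
        rcases eq_or_ne (u i : ℝ) (u j) with h | h
        · simp [h]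
        · have hp : 0 < |(u i : ℝ) - u j| := abs_pos.2 (sub_ne_zero.2 h)
          rw [← div_le_iff₀ hp]
          rw [← ENNReal.ofReal_le_iff_le_toReal ((hEH x).trans_lt ENNReal.ofReal_lt_top).ne]
          exact le_iSup (fun p : ℕ × ℕ =>
            ENNReal.ofReal (|g (u p.1) x - g (u p.2) x| / |(u p.1 : ℝ) - u p.2|)) (i, j)
    intro θ hθ θ' hθ'
    exact key ⟨θ, hθ⟩ ⟨θ', hθ'⟩

/-- Hellinger affinity of two distinct densities is less than one. -/
lemma affinity_lt_one {𝓧 : Type*} [MeasurableSpace 𝓧] (μ : Measure 𝓧) (p q : 𝓧 → ℝ)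
    (hp : ∀ x, 0 < p x) (hq : ∀ x, 0 < q x) (hpm : Measurable p) (hqm : Measurable q)
    (hp1 : ∫ x, p x ∂μ = 1) (hq1 : ∫ x, q x ∂μ = 1) (hne : ¬ p =ᵐ[μ] q) :
    ∫ x, Real.sqrt (p x) * Real.sqrt (q x) ∂μ < 1 := by
  have hpi : Integrable p μ := by
    by_contra h
    rw [integral_undef h] at hp1; norm_num at hp1
  have hqi : Integrable q μ := by
    by_contra h
    rw [integral_undef h] at hq1; norm_num at hq1
  have hsi : Integrable (fun x => Real.sqrt (p x) * Real.sqrt (q x)) μ := by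
    refine (hpi.add hqi).mono' (by fun_prop) (ae_of_all _ fun x => ?_)
    have h1 := Real.sq_sqrt (hp x).le
    have h2 := Real.sq_sqrt (hq x).le
    rw [Real.norm_of_nonneg (by positivity)]
    simp only [Pi.add_apply]
    nlinarith [sq_nonneg (√(p x) - √(q x)), hp x, hq x]
  have hexp : ∀ x, (√(p x) - √(q x)) ^ 2 = p x + q x - 2 * (√(p x) * √(q x)) := by
    intro x
    have h1 := Real.sq_sqrt (hp x).le
    have h2 := Real.sq_sqrt (hq x).le
    nlinarith
  have hint : ∫ x, (√(p x) - √(q x)) ^ 2 ∂μ = 2 - 2 * ∫ x, √(p x) * √(q x) ∂μ := by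
    simp_rw [hexp]
    rw [integral_sub (f := fun x => p x + q x) (hpi.add hqi) (hsi.const_mul 2), integral_add hpi hqi, integral_const_mul,
      hp1, hq1]
    norm_num
  have hi2 : Integrable (fun x => (√(p x) - √(q x)) ^ 2) μ := by
    simp_rw [hexp]
    exact (hpi.add hqi).sub (hsi.const_mul 2)
  have hpos : 0 < ∫ x, (√(p x) - √(q x)) ^ 2 ∂μ := by
    refine lt_of_le_of_ne (integral_nonneg fun x => sq_nonneg _) fun h => hne ?_
    have h0 := (integral_eq_zero_iff_of_nonneg (fun x => sq_nonneg _) hi2).1 h.symm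
    filter_upwards [h0] with x hx
    have : √(p x) = √(q x) := sub_eq_zero.1 (pow_eq_zero_iff (two_ne_zero) |>.1 hx)
    exact (Real.sqrt_inj (hp x).le (hq x).le).1 this
  linarith

/-- Chernoff bound for i.i.d. sums. -/
lemma chernoff_iid {𝓧 Ω : Type*} [MeasurableSpace 𝓧] [MeasurableSpace Ω] (P : Measure Ω)
    [IsProbabilityMeasure P] (X : ℕ → Ω → 𝓧) (hX_meas : ∀ i, Measurable (X i))
    (hX_indep : iIndepFun X P) (hlaw : ∀ i, Measure.map (X i) P = Measure.map (X 0) P)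
    (Y : 𝓧 → ℝ) (hY : Measurable Y) (t : ℝ) (ht : 0 ≤ t)
    (hint : Integrable (fun ω => Real.exp (t * Y (X 0 ω))) P) (n : ℕ) :
    P {ω | 0 ≤ ∑ i ∈ Finset.range n, Y (X i ω)} ≤
      ENNReal.ofReal ((∫ ω, Real.exp (t * Y (X 0 ω)) ∂P) ^ n) := by
  have hid : ∀ i, IdentDistrib (fun ω => Real.exp (t * Y (X i ω)))
      (fun ω => Real.exp (t * Y (X 0 ω))) P P := by
    intro i
    have h : IdentDistrib (X i) (X 0) P P :=
      ⟨(hX_meas i).aemeasurable, (hX_meas 0).aemeasurable, hlaw i⟩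
    exact h.comp (u := fun x => Real.exp (t * Y x)) (by fun_prop)
  have hind : iIndepFun (fun i ω => Y (X i ω)) P := hX_indep.comp (fun _ => Y) (fun _ => hY)
  have hm : ∀ i, Measurable (fun ω => Y (X i ω)) := fun i => hY.comp (hX_meas i)
  have hints : Integrable (fun ω => Real.exp (t * (∑ i ∈ Finset.range n, fun ω => Y (X i ω)) ω)) P :=
    hind.integrable_exp_mul_sum hm (fun i _ => (hid i).integrable_iff.2 hint)
  have h1 := measure_ge_le_exp_mul_mgf (μ := P)
    (X := ∑ i ∈ Finset.range n, fun ω => Y (X i ω)) 0 ht hints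
  rw [hind.mgf_sum hm] at h1
  have h2 : ∀ i ∈ Finset.range n, mgf (fun ω => Y (X i ω)) P t
      = ∫ ω, Real.exp (t * Y (X 0 ω)) ∂P := fun i _ => (hid i).integral_eq
  rw [Finset.prod_congr rfl h2] at h1
  simp only [mul_zero, Real.exp_zero, one_mul, Finset.prod_const, Finset.card_range,
    Finset.sum_apply] at h1
  rw [← ofReal_measureReal]
  exact ENNReal.ofReal_le_ofReal h1

theorem stmt0
    -- the sample space with a σ-finite base measure
    {𝓧 : Type*} [MeasurableSpace 𝓧] (μ : Measure 𝓧) [SigmaFinite μ]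
    -- the parameter set: open, with compact closure K bounded by B
    (Θ : Set ℝ) (hΘopen : IsOpen Θ) (K : Set ℝ) (hK : K = closure Θ)
    (hKcpt : IsCompact K) (B : ℝ) (hB : ∀ θ ∈ K, |θ| ≤ B)
    -- the statistical model: positive densities, measurable, integrating to one
    (f : ℝ → 𝓧 → ℝ)
    (hf_pos : ∀ θ ∈ K, ∀ x, 0 < f θ x)
    (hf_meas : ∀ θ ∈ K, Measurable (f θ))
    (hf_prob : ∀ θ ∈ K, ∫ x, f θ x ∂μ = 1)
    -- a.e. smoothness: θ ↦ log f(x|θ) is twice differentiable on Θ, continuous on K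
    (hf_smooth : ∀ᵐ x ∂μ,
      (∀ θ ∈ Θ, DifferentiableAt ℝ (fun t => Real.log (f t x)) θ) ∧
      (∀ θ ∈ Θ, DifferentiableAt ℝ (deriv (fun t => Real.log (f t x))) θ) ∧
      ContinuousOn (fun t => Real.log (f t x)) K)
    -- identifiability
    (hident : ∀ θ ∈ K, ∀ θ' ∈ K, f θ =ᵐ[μ] f θ' → θ = θ')
    -- the true parameter
    (θ₀ : ℝ) (hθ₀ : θ₀ ∈ Θ)
    -- the score function
    (s : ℝ → 𝓧 → ℝ) (hs : ∀ θ x, s θ x = deriv (fun t => Real.log (f t x)) θ)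
    -- the Fisher information at θ₀: finite and strictly positive
    (IFi : ℝ) (hIFi_int : Integrable (fun x => deriv (fun t => s t x) θ₀ * f θ₀ x) μ)
    (hIFi : IFi = -∫ x, deriv (fun t => s t x) θ₀ * f θ₀ x ∂μ) (hIFi_pos : 0 < IFi)
    -- the i.i.d. samples X₁, X₂, … with density f(·|θ₀)
    {Ω : Type*} [MeasurableSpace Ω] (P : Measure Ω) [IsProbabilityMeasure P]
    (X : ℕ → Ω → 𝓧) (hX_meas : ∀ i, Measurable (X i))
    (hX_indep : iIndepFun X P)
    (hX_law : ∀ i, Measure.map (X i) P = μ.withDensity (fun x => ENNReal.ofReal (f θ₀ x)))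
    -- the maximum likelihood estimator θ̂ₙ, a measurable maximizer of Lₙ over K
    (θhat : ℕ → Ω → ℝ) (hθhat_meas : ∀ n, Measurable (θhat n))
    (hθhat_mem : ∀ (n : ℕ) (ω : Ω), θhat n ω ∈ K)
    (hθhat_max : ∀ (n : ℕ) (ω : Ω), ∀ θ ∈ K,
      (1 / (n : ℝ)) * ∑ i ∈ Finset.range n, Real.log (f θ (X i ω)) ≤
      (1 / (n : ℝ)) * ∑ i ∈ Finset.range n, Real.log (f (θhat n ω) (X i ω)))
    -- Assumption 1: sub-Gaussian Lipschitz envelope for the log-likelihood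
    (H : 𝓧 → ℝ) (hH_nonneg : ∀ x, 0 ≤ H x)
    (hH_lip : ∀ x, ∀ θ ∈ K, ∀ θ' ∈ K,
      |Real.log (f θ x) - Real.log (f θ' x)| ≤ H x * |θ - θ'|)
    (hH_subG : SubGaussianTail P (fun ω => H (X 0 ω)))
    -- Assumption 2: sub-exponential control of the score derivative
    (Hbar : 𝓧 → ℝ) (hHbar_nonneg : ∀ x, 0 ≤ Hbar x)
    (hHbar_lip : ∀ x, ∀ θ ∈ K,
      |deriv (fun t => s t x) θ₀ - deriv (fun t => s t x) θ| ≤ Hbar x * |θ - θ₀|)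
    (hscore_subE : SubExponentialTail P (fun ω => deriv (fun t => s t (X 0 ω)) θ₀))
    (hHbar_subE : SubExponentialTail P (fun ω => Hbar (X 0 ω))) :
    -- STATEMENT: exponential consistency of the MLE
    ∀ ε > 0, ∃ C > 0, ∃ c > 0, ∀ n : ℕ, 1 ≤ n →
      P {ω | ε ≤ |θhat n ω - θ₀|} ≤ ENNReal.ofReal (C * Real.exp (-c * n)) := by
  intro ε hε
  have hθ₀K : θ₀ ∈ K := hK ▸ subset_closure hθ₀
  obtain ⟨G, hGm, hG0, hGH, hGlip⟩ := exists_measurable_envelope K ⟨θ₀, hθ₀K⟩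
    (fun θ x => Real.log (f θ x)) (fun θ hθ => (hf_meas θ hθ).log) H hH_nonneg hH_lip
  have hGt : SubGaussianTail P (fun ω => G (X 0 ω)) := by
    obtain ⟨C, hC, c, hc, h⟩ := hH_subG
    refine ⟨C, hC, c, hc, fun t ht => le_trans (measure_mono ?_) (h t ht)⟩
    intro ω hω
    simp only [Set.mem_ofPred_eq] at hω ⊢
    rw [abs_of_nonneg (hG0 _)] at hω
    exact hω.trans ((hGH _).trans (le_abs_self _))
  have hGX : Measurable (fun ω => G (X 0 ω)) := hGm.comp (hX_meas 0)
  have hGexp := integrable_exp_of_tail P _ hGX (fun ω => hG0 _) hGt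
  have hScpt : IsCompact (K ∩ {θ | ε ≤ |θ - θ₀|}) :=
    hKcpt.inter_right (isClosed_le continuous_const (by fun_prop))
  have key : ∃ C > 0, ∃ c > 0, ∀ n : ℕ, 1 ≤ n →
      P {ω | θhat n ω ∈ K ∩ {θ | ε ≤ |θ - θ₀|}} ≤ ENNReal.ofReal (C * Real.exp (-c * n)) := by
    refine hScpt.induction_on (p := fun S => ∃ C > 0, ∃ c > 0, ∀ n : ℕ, 1 ≤ n →
      P {ω | θhat n ω ∈ S} ≤ ENNReal.ofReal (C * Real.exp (-c * n))) ?_ ?_ ?_ ?_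
    · exact ⟨1, one_pos, 1, one_pos, fun n _ => by simp⟩
    · rintro S T hST ⟨C, hC, c, hc, h⟩
      refine ⟨C, hC, c, hc, fun n hn => le_trans (measure_mono ?_) (h n hn)⟩
      intro ω hω
      exact hST hω
    · rintro S T ⟨C, hC, c, hc, h⟩ ⟨C', hC', c', hc', h'⟩
      refine ⟨C + C', by positivity, min c c', lt_min hc hc', fun n hn => ?_⟩
      have e1 : Real.exp (-c * n) ≤ Real.exp (-(min c c') * n) := by
        gcongr; exact min_le_left _ _
      have e2 : Real.exp (-c' * n) ≤ Real.exp (-(min c c') * n) := by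
        gcongr; exact min_le_right _ _
      calc P {ω | θhat n ω ∈ S ∪ T}
          ≤ P {ω | θhat n ω ∈ S} + P {ω | θhat n ω ∈ T} := measure_union_le _ _
        _ ≤ _ := add_le_add (h n hn) (h' n hn)
        _ = ENNReal.ofReal (C * Real.exp (-c * n) + C' * Real.exp (-c' * n)) :=
          (ENNReal.ofReal_add (by positivity) (by positivity)).symm
        _ ≤ _ := by
          apply ENNReal.ofReal_le_ofReal
          rw [add_mul]
          gcongr
    · rintro θ ⟨hθK, hθε⟩
      have hne : θ ≠ θ₀ := by
        rintro rfl
        simp at hθε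
        linarith
      have hnae : ¬ f θ =ᵐ[μ] f θ₀ := fun h => hne (hident θ hθK θ₀ hθ₀K h)
      have haff := affinity_lt_one μ (f θ) (f θ₀) (hf_pos θ hθK) (hf_pos θ₀ hθ₀K)
        (hf_meas θ hθK) (hf_meas θ₀ hθ₀K) (hf_prob θ hθK) (hf_prob θ₀ hθ₀K) hnae
      have hm1 : Measurable (fun x => Real.log (f θ x)) := (hf_meas θ hθK).log
      have hm0 : Measurable (fun x => Real.log (f θ₀ x)) := (hf_meas θ₀ hθ₀K).log
      let Y : ℝ → 𝓧 → ℝ := fun δ x => Real.log (f θ x) - Real.log (f θ₀ x) + δ * G x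
      have hY : ∀ δ, Measurable (Y δ) := fun δ => (hm1.sub hm0).add (hGm.const_mul δ)
      have hYX : ∀ δ, Measurable (fun ω => Real.exp (1 / 2 * Y δ (X 0 ω))) := fun δ =>
        (((hY δ).comp (hX_meas 0)).const_mul _).exp
      -- identification of the limit
      have hlim : ∫ ω, Real.exp (1 / 2 * Y 0 (X 0 ω)) ∂P < 1 := by
        refine lt_of_eq_of_lt ?_ haff
        have h1 : ∫ ω, Real.exp (1 / 2 * Y 0 (X 0 ω)) ∂P
            = ∫ x, Real.exp (1 / 2 * Y 0 x) ∂(Measure.map (X 0) P) :=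
          (integral_map (hX_meas 0).aemeasurable
            (((hY 0).const_mul (1 / 2)).exp.aestronglyMeasurable)).symm
        rw [h1, hX_law 0, integral_withDensity_eq_integral_toReal_smul
          (hf_meas θ₀ hθ₀K).ennreal_ofReal (ae_of_all _ fun x => ENNReal.ofReal_lt_top)]
        congr 1
        ext x
        have p1 := hf_pos θ hθK x
        have p0 := hf_pos θ₀ hθ₀K x
        rw [ENNReal.toReal_ofReal p0.le, smul_eq_mul]
        have e : Real.exp (1 / 2 * Y 0 x) = √(f θ x) / √(f θ₀ x) := by
          rw [← Real.exp_log (Real.sqrt_pos.2 p1), ← Real.exp_log (Real.sqrt_pos.2 p0),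
            ← Real.exp_sub, Real.log_sqrt p1.le, Real.log_sqrt p0.le]
          simp only [Y]
          congr 1
          ring
        rw [e]
        have hs0 := Real.sqrt_pos.2 p0
        have hsq := Real.sq_sqrt p0.le
        field_simp
        rw [hsq]
      -- domination
      have hdom : ∀ δ, 0 ≤ δ → δ ≤ 1 → ∀ ω, ‖Real.exp (1 / 2 * Y δ (X 0 ω))‖
          ≤ Real.exp ((|θ - θ₀| + 1) / 2 * G (X 0 ω)) := by
        intro δ h0 h1 ω
        rw [Real.norm_of_nonneg (Real.exp_pos _).le]
        apply Real.exp_le_exp.2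
        have a1 := (le_abs_self _).trans (hGlip (X 0 ω) θ hθK θ₀ hθ₀K)
        have a2 : δ * G (X 0 ω) ≤ 1 * G (X 0 ω) := by
          gcongr
          exact hG0 _
        simp only [Y]
        linarith
      have hbd := hGexp ((|θ - θ₀| + 1) / 2) (by positivity)
      have hseq0 : ∀ k : ℕ, (0 : ℝ) ≤ 1 / ((k : ℝ) + 1) := fun k => by positivity
      have hseq1 : ∀ k : ℕ, 1 / ((k : ℝ) + 1) ≤ 1 := fun k => by
        rw [div_le_one (by positivity)]
        have : (0 : ℝ) ≤ k := Nat.cast_nonneg k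
        linarith
      have htend : Tendsto (fun k : ℕ => ∫ ω, Real.exp (1 / 2 * Y (1 / ((k : ℝ) + 1)) (X 0 ω)) ∂P)
          atTop (nhds (∫ ω, Real.exp (1 / 2 * Y 0 (X 0 ω)) ∂P)) := by
        refine tendsto_integral_of_dominated_convergence _
          (fun k => (hYX _).aestronglyMeasurable) hbd
          (fun k => ae_of_all _ (hdom _ (hseq0 k) (hseq1 k))) (ae_of_all _ fun ω => ?_)
        have hc : Continuous (fun δ : ℝ => Real.exp (1 / 2 * Y δ (X 0 ω))) := by
          simp only [Y]
          fun_prop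
        exact (hc.tendsto 0).comp tendsto_one_div_add_atTop_nhds_zero_nat
      obtain ⟨k, hk⟩ := (htend.eventually (gt_mem_nhds hlim)).exists
      have hδ : (0 : ℝ) < 1 / ((k : ℝ) + 1) := by positivity
      have hd := hdom _ (hseq0 k) (hseq1 k)
      generalize (1 / ((k : ℝ) + 1) : ℝ) = δ at hk hδ hd
      have hYint : Integrable (fun ω => Real.exp (1 / 2 * Y δ (X 0 ω))) P :=
        hbd.mono' (hYX δ).aestronglyMeasurable (ae_of_all _ hd)
      have hρ : 0 < ∫ ω, Real.exp (1 / 2 * Y δ (X 0 ω)) ∂P := integral_exp_pos hYint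
      refine ⟨Metric.ball θ δ ∩ K, ?_, 1, one_pos,
        -Real.log (∫ ω, Real.exp (1 / 2 * Y δ (X 0 ω)) ∂P), ?_, ?_⟩
      · exact mem_nhdsWithin_iff_exists_mem_nhds_inter.2
          ⟨Metric.ball θ δ, Metric.ball_mem_nhds θ hδ, fun z hz => ⟨hz.1, hz.2.1⟩⟩
      · exact neg_pos.2 (Real.log_neg hρ hk)
      · intro n hn
        have hch := chernoff_iid P X hX_meas hX_indep (fun i => by rw [hX_law i, hX_law 0])
          (Y δ) (hY δ) (1 / 2) (by norm_num) hYint n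
        refine le_trans (measure_mono ?_) (hch.trans (le_of_eq ?_))
        · rintro ω ⟨hb, -⟩
          have hn0 : (0 : ℝ) < 1 / (n : ℝ) := by
            have : (0 : ℝ) < n := by exact_mod_cast hn
            positivity
          have hmx := le_of_mul_le_mul_left (hθhat_max n ω θ₀ hθ₀K) hn0
          have hle : ∑ i ∈ Finset.range n,
              (Real.log (f (θhat n ω) (X i ω)) - Real.log (f θ₀ (X i ω)))
              ≤ ∑ i ∈ Finset.range n, Y δ (X i ω) := by
            refine Finset.sum_le_sum fun i _ => ?_
            have a1 := (le_abs_self _).trans (hGlip (X i ω) _ (hθhat_mem n ω) θ hθK)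
            have a2 : |θhat n ω - θ| ≤ δ := by
              rw [Metric.mem_ball, Real.dist_eq] at hb
              exact hb.le
            have a3 : G (X i ω) * |θhat n ω - θ| ≤ G (X i ω) * δ :=
              mul_le_mul_of_nonneg_left a2 (hG0 _)
            simp only [Y]
            linarith
          rw [Finset.sum_sub_distrib] at hle
          simp only [Set.mem_ofPred_eq]
          linarith
        · rw [one_mul, neg_neg, mul_comm, Real.exp_nat_mul, Real.exp_log hρ]
  obtain ⟨C, hC, c, hc, h⟩ := key
  refine ⟨C, hC, c, hc, fun n hn => le_trans (measure_mono ?_) (h n hn)⟩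
  intro ω hω
  exact ⟨hθhat_mem n ω, hω⟩
end

section
/- Under Assumptions 1 and 2, the normalized estimation errors Z_n are uniformly sub-Gaussian: there exist constants C > 0 and c > 0, independent of n, such that for every n ≥ 1 and every t > 0, P(|Z_n| ≥ t) ≤ C·exp(−c·t²). -/
open MeasureTheory ProbabilityTheory Filter Real Set

lemma aux_exp_moment {Ω : Type*} [MeasurableSpace Ω] (P : Measure Ω) [IsProbabilityMeasure P]
    (W : Ω → ℝ) (hW : AEMeasurable W P) (h : SubExponentialTail P W) :
    ∃ a > 0, Integrable (fun ω => Real.exp (a * |W ω|)) P := by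
  obtain ⟨C, hC, c, hc, ht⟩ := h
  refine ⟨c / 2, by positivity, ?_⟩
  have hmeas : AEMeasurable (fun ω => Real.exp (c / 2 * |W ω|)) P := by fun_prop
  refine ⟨hmeas.aestronglyMeasurable, ?_⟩
  rw [hasFiniteIntegral_iff_ofReal (ae_of_all _ fun ω => (Real.exp_pos _).le)]
  set T : ℕ → Ω → ENNReal := fun k =>
    {ω | (k : ℝ) ≤ |W ω|}.indicator (fun _ => ENNReal.ofReal (Real.exp (c / 2 * (k + 1)))) with hT
  have hset : ∀ k : ℕ, NullMeasurableSet {ω | (k : ℝ) ≤ |W ω|} P := fun k =>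
    nullMeasurableSet_le aemeasurable_const (by fun_prop)
  have h1 : ∀ ω, ENNReal.ofReal (Real.exp (c / 2 * |W ω|)) ≤ ∑' k, T k ω := by
    intro ω
    refine le_trans ?_ (ENNReal.le_tsum ⌊|W ω|⌋₊)
    have hfl : ((⌊|W ω|⌋₊ : ℕ) : ℝ) ≤ |W ω| := Nat.floor_le (abs_nonneg _)
    simp only [hT, Set.indicator, Set.mem_ofPred_eq, hfl, if_true]
    apply ENNReal.ofReal_le_ofReal
    apply Real.exp_le_exp.2
    have := (Nat.lt_floor_add_one |W ω|).le
    gcongr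
  have h2 : ∀ k, ∫⁻ ω, T k ω ∂P ≤
      ENNReal.ofReal ((C + 1) * Real.exp (c / 2) * (Real.exp (-(c / 2))) ^ k) := by
    intro k
    rw [hT]
    simp only
    rw [lintegral_indicator_const₀ (hset k)]
    have hb : P {ω | (k : ℝ) ≤ |W ω|} ≤ ENNReal.ofReal ((C + 1) * Real.exp (-c * k)) := by
      rcases Nat.eq_zero_or_pos k with rfl | hk
      · refine prob_le_one.trans ?_
        simp only [Nat.cast_zero, mul_zero, Real.exp_zero, mul_one]
        rw [← ENNReal.ofReal_one]
        exact ENNReal.ofReal_le_ofReal (by linarith)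
      · refine (ht k (by exact_mod_cast hk)).trans (ENNReal.ofReal_le_ofReal ?_)
        gcongr
        linarith
    calc _ ≤ ENNReal.ofReal (Real.exp (c / 2 * (k + 1))) *
          ENNReal.ofReal ((C + 1) * Real.exp (-c * k)) := by gcongr
      _ = _ := by
        rw [← ENNReal.ofReal_mul (Real.exp_pos _).le]
        congr 1
        rw [← Real.exp_nat_mul, mul_left_comm, mul_assoc, ← Real.exp_add, ← Real.exp_add]
        congr 2
        ring
  calc ∫⁻ ω, ENNReal.ofReal (Real.exp (c / 2 * |W ω|)) ∂P
      ≤ ∫⁻ ω, ∑' k, T k ω ∂P := lintegral_mono h1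
    _ = ∑' k, ∫⁻ ω, T k ω ∂P := lintegral_tsum fun k =>
        aemeasurable_const.indicator₀ (hset k)
    _ ≤ ∑' k : ℕ, ENNReal.ofReal ((C + 1) * Real.exp (c / 2) * (Real.exp (-(c / 2))) ^ k) :=
        ENNReal.tsum_le_tsum h2
    _ < ⊤ := by
        have hs : Summable (fun k : ℕ => (C + 1) * Real.exp (c / 2) * (Real.exp (-(c / 2))) ^ k) := by
          apply Summable.mul_left
          apply summable_geometric_of_lt_one (Real.exp_pos _).le
          rw [Real.exp_lt_one_iff]
          linarith
        exact hs.tsum_ofReal_lt_top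

lemma aux_zero_mem {𝓧 : Type*} [MeasurableSpace 𝓧] (ν : Measure 𝓧) [IsProbabilityMeasure ν]
    (g : 𝓧 → ℝ) (hg : AEMeasurable g ν) (a : ℝ) (ha : 0 < a)
    (hint : Integrable (fun x => Real.exp (a * |g x|)) ν) :
    (0 : ℝ) ∈ interior (integrableExpSet g ν) := by
  rw [mem_interior_iff_mem_nhds]
  filter_upwards [Ioo_mem_nhds (neg_lt_zero.2 ha) ha] with t ht
  have : AEMeasurable (fun x => Real.exp (t * g x)) ν := by fun_prop
  refine hint.mono' this.aestronglyMeasurable (ae_of_all _ fun x => ?_)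
  rw [Real.norm_eq_abs, abs_of_pos (Real.exp_pos _)]
  apply Real.exp_le_exp.2
  calc t * g x ≤ |t * g x| := le_abs_self _
    _ = |t| * |g x| := abs_mul _ _
    _ ≤ a * |g x| := by
      gcongr
      exact (abs_lt.2 ht).le

lemma aux_chernoff {𝓧 : Type*} [MeasurableSpace 𝓧] (ν : Measure 𝓧) [IsProbabilityMeasure ν]
    {Ω : Type*} [MeasurableSpace Ω] (P : Measure Ω) [IsProbabilityMeasure P]
    (X : ℕ → Ω → 𝓧) (hX_meas : ∀ i, Measurable (X i))
    (hX_indep : iIndepFun (m := fun _ => ‹MeasurableSpace 𝓧›) X P)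
    (hX_law : ∀ i, Measure.map (X i) P = ν)
    (g : 𝓧 → ℝ) (hg : AEMeasurable g ν) (a : ℝ) (ha : 0 < a)
    (hint : Integrable (fun x => Real.exp (a * |g x|)) ν) (m : ℝ) (hm : ∫ x, g x ∂ν < m) :
    ∃ c > 0, ∀ n : ℕ, P {ω | n * m ≤ ∑ i ∈ Finset.range n, g (X i ω)} ≤
      ENNReal.ofReal (Real.exp (-c * n)) := by
  wlog hgm : Measurable g generalizing g
  · have hae := hg.ae_eq_mk
    obtain ⟨c, hc, h⟩ := this (hg.mk g) hg.measurable_mk.aemeasurable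
      (hint.congr (by filter_upwards [hae] with x hx using by simp [hx]))
      (by rwa [← integral_congr_ae hae]) hg.measurable_mk
    refine ⟨c, hc, fun n => le_trans (measure_mono_ae ?_) (h n)⟩
    have : ∀ i, ∀ᵐ ω ∂P, g (X i ω) = hg.mk g (X i ω) := fun i => by
      apply ae_of_ae_map (hX_meas i).aemeasurable (p := fun x => g x = hg.mk g x)
      rw [hX_law i]; exact hae
    filter_upwards [ae_all_iff.2 this] with ω hω h'
    have h2 : n * m ≤ ∑ i ∈ Finset.range n, g (X i ω) := h'
    simp only [hω] at h2
    exact h2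
  have h0 := aux_zero_mem ν g hg a ha hint
  have hd : HasDerivAt (fun t => mgf g ν t * Real.exp (-t * m)) (∫ x, g x ∂ν - m) 0 := by
    have h1 := hasDerivAt_mgf h0
    have h2 : HasDerivAt (fun t : ℝ => Real.exp (-t * m)) (-m) 0 := by
      have := (((hasDerivAt_id (0:ℝ)).neg.mul_const m).exp)
      simpa using this
    have := h1.mul h2
    have h3 : (∫ (x : 𝓧), (fun ω => g ω * rexp (0 * g ω)) x ∂ν) * rexp (-0 * m) +
        mgf g ν 0 * -m = ∫ x, g x ∂ν - m := by
      simp [sub_eq_add_neg]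
    rw [h3] at this
    exact this
  have hex : ∃ t, 0 < t ∧ t ∈ integrableExpSet g ν ∧ mgf g ν t * Real.exp (-t * m) < 1 := by
    have h3 := hd.tendsto_slope_zero_right
    have h4 := h3.eventually (gt_mem_nhds (sub_neg.2 hm))
    have h5 : ∀ᶠ t in nhdsWithin (0:ℝ) (Set.Ioi 0), t ∈ integrableExpSet g ν :=
      mem_nhdsWithin_of_mem_nhds (mem_interior_iff_mem_nhds.1 h0)
    obtain ⟨t, h4, h5, ht⟩ := (h4.and (h5.and self_mem_nhdsWithin)).exists
    have ht : 0 < t := ht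
    refine ⟨t, ht, h5, ?_⟩
    simp only [zero_add, mgf_zero, neg_zero, zero_mul, Real.exp_zero, mul_one, smul_eq_mul] at h4
    rw [← div_eq_inv_mul, div_lt_iff₀ ht] at h4
    simp at h4
    simpa using h4
  obtain ⟨t, ht, hti, hlt⟩ := hex
  set q := mgf g ν t * Real.exp (-t * m) with hq
  have hqpos : 0 < q := mul_pos (mgf_pos hti) (Real.exp_pos _)
  refine ⟨-Real.log q, by have := Real.log_neg hqpos hlt; linarith, fun n => ?_⟩
  have hind : iIndepFun (fun i ω => g (X i ω)) P := hX_indep.comp (fun _ => g) fun _ => hgm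
  have hm' : ∀ i, Measurable (fun ω => g (X i ω)) := fun i => hgm.comp (hX_meas i)
  have hi : ∀ i, Integrable (fun ω => Real.exp (t * g (X i ω))) P := fun i => by
    have : Integrable (fun x => Real.exp (t * g x)) (Measure.map (X i) P) := by
      rw [hX_law i]; exact hti
    exact this.comp_measurable (hX_meas i)
  have hmgf : ∀ i, mgf (fun ω => g (X i ω)) P t = mgf g ν t := fun i => by
    rw [← hX_law i, mgf_map (hX_meas i).aemeasurable]
    · rfl
    · have : Measurable (fun x => Real.exp (t * g x)) := by fun_prop
      exact this.aestronglyMeasurable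
  have hmain := measure_ge_le_exp_mul_mgf (μ := P) (X := ∑ i ∈ Finset.range n, fun ω => g (X i ω))
    (n * m) ht.le (hind.integrable_exp_mul_sum hm' (fun i _ => hi i))
  rw [hind.mgf_sum hm'] at hmain
  simp only [hmgf, Finset.prod_const, Finset.card_range, Finset.sum_apply] at hmain
  have heq : Real.exp (-t * (n * m)) * mgf g ν t ^ n = Real.exp (- -Real.log q * n) := by
    rw [neg_neg, mul_comm (Real.log q), Real.exp_nat_mul, Real.exp_log hqpos, hq, mul_pow,
      ← Real.exp_nat_mul, mul_comm]
    congr 2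
    ring
  rw [heq] at hmain
  rw [← ofReal_measureReal]
  exact ENNReal.ofReal_le_ofReal hmain

lemma aux_exp_le (x : ℝ) : Real.exp x ≤ x + Real.exp (x ^ 2) := by
  rcases le_or_gt |x| 1 with h | h
  · have := (abs_le.1 (Real.abs_exp_sub_one_sub_id_le h)).2
    have := Real.add_one_le_exp (x ^ 2)
    linarith
  · rcases lt_abs.1 h with h | h
    · have : Real.exp x ≤ Real.exp (x ^ 2) := Real.exp_le_exp.2 (by nlinarith)
      linarith
    · have h1 := Real.add_one_le_exp (x ^ 2)
      have h2 : Real.exp x ≤ 1 := Real.exp_le_one_iff.2 (by linarith)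
      nlinarith

lemma aux_exp_conv (p y : ℝ) (hp : 0 ≤ p) (hp1 : p ≤ 1) :
    Real.exp (p * y) ≤ 1 + p * (Real.exp y - 1) := by
  have := convexOn_exp.2 (Set.mem_univ (0:ℝ)) (Set.mem_univ y) (sub_nonneg.2 hp1) hp (by ring)
  simp only [smul_eq_mul, mul_zero, zero_add, Real.exp_zero] at this
  linarith

lemma aux_subG {𝓧 : Type*} [MeasurableSpace 𝓧] (ν : Measure 𝓧) [IsProbabilityMeasure ν]
    (g : 𝓧 → ℝ) (hg : AEMeasurable g ν) (a : ℝ) (ha : 0 < a)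
    (hint : Integrable (fun x => Real.exp (a * (g x) ^ 2)) ν) (hgi : Integrable g ν)
    (hm : ∫ x, g x ∂ν = 0) :
    ∃ c : NNReal, 0 < c ∧ HasSubgaussianMGF g c ν := by
  set D := ∫ x, Real.exp (a * (g x) ^ 2) ∂ν with hD
  have hD1 : 1 ≤ D := by
    have : ∫ x, (1:ℝ) ∂ν ≤ D := integral_mono (integrable_const _) hint
      (fun x => Real.one_le_exp (by positivity))
    simpa using this
  set c : ℝ := 2 * ((D - 1) / a + 1 / (4 * a)) with hc
  have hcpos : 0 < c := by
    have : 0 ≤ (D - 1) / a := div_nonneg (by linarith) ha.le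
    positivity
  have hptw : ∀ t x, Real.exp (t * g x) ≤ Real.exp (t ^ 2 / (4 * a)) * Real.exp (a * g x ^ 2) := by
    intro t x
    rw [← Real.exp_add]
    apply Real.exp_le_exp.2
    have : t ^ 2 / (4 * a) + a * g x ^ 2 - t * g x = (t / 2 - a * g x) ^ 2 / a := by
      field_simp; ring
    have h2 : 0 ≤ (t / 2 - a * g x) ^ 2 / a := by positivity
    linarith
  have hi : ∀ t, Integrable (fun x => Real.exp (t * g x)) ν := by
    intro t
    have : AEMeasurable (fun x => Real.exp (t * g x)) ν := by fun_prop
    refine (hint.const_mul (Real.exp (t ^ 2 / (4 * a)))).mono' this.aestronglyMeasurable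
      (ae_of_all _ fun x => ?_)
    rw [Real.norm_eq_abs, abs_of_pos (Real.exp_pos _)]
    exact hptw t x
  refine ⟨⟨c, hcpos.le⟩, hcpos, hi, fun t => ?_⟩
  change ∫ x, Real.exp (t * g x) ∂ν ≤ Real.exp (c * t ^ 2 / 2)
  rcases le_or_gt (t ^ 2 / a) 1 with hp | hp
  · have h1 : ∫ x, Real.exp (t * g x) ∂ν ≤
        ∫ x, (t * g x + (1 + t ^ 2 / a * (Real.exp (a * g x ^ 2) - 1))) ∂ν := by
      apply integral_mono (hi t)
      · exact (hgi.const_mul t).add ((integrable_const _).add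
          ((hint.sub (integrable_const _)).const_mul _))
      · intro x
        have h1 := aux_exp_le (t * g x)
        have h2 := aux_exp_conv (t ^ 2 / a) (a * g x ^ 2) (by positivity) hp
        have h3 : t ^ 2 / a * (a * g x ^ 2) = (t * g x) ^ 2 := by field_simp
        rw [h3] at h2
        simp only
        linarith
    have h2 : ∫ x, (t * g x + (1 + t ^ 2 / a * (Real.exp (a * g x ^ 2) - 1))) ∂ν =
        1 + t ^ 2 / a * (D - 1) := by
      have e1 : Integrable (fun x => Real.exp (a * g x ^ 2) - 1) ν := hint.sub (integrable_const _)
      have e2 : Integrable (fun x => t ^ 2 / a * (Real.exp (a * g x ^ 2) - 1)) ν := e1.const_mul _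
      have e3 : Integrable (fun x => 1 + t ^ 2 / a * (Real.exp (a * g x ^ 2) - 1)) ν :=
        (integrable_const _).add e2
      rw [integral_add (hgi.const_mul t) e3, integral_const_mul, hm,
        integral_add (integrable_const _) e2,
        integral_const_mul, integral_sub hint (integrable_const _)]
      simp [hD]
    rw [h2] at h1
    refine h1.trans ?_
    rw [add_comm]
    refine (Real.add_one_le_exp _).trans (Real.exp_le_exp.2 ?_)
    have : c * t ^ 2 / 2 = t ^ 2 / a * (D - 1) + t ^ 2 / (4 * a) := by
      rw [hc]; field_simp
    have h2 : 0 ≤ t ^ 2 / (4 * a) := by positivity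
    linarith
  · have h1 : ∫ x, Real.exp (t * g x) ∂ν ≤ Real.exp (t ^ 2 / (4 * a)) * D := by
      rw [hD, ← integral_const_mul]
      exact integral_mono (hi t) (hint.const_mul _) (hptw t)
    refine h1.trans ?_
    have h2 : D ≤ Real.exp (D - 1) := by have := Real.add_one_le_exp (D - 1); linarith
    refine (mul_le_mul_of_nonneg_left h2 (Real.exp_pos _).le).trans ?_
    rw [← Real.exp_add]
    apply Real.exp_le_exp.2
    have : c * t ^ 2 / 2 = t ^ 2 / a * (D - 1) + t ^ 2 / (4 * a) := by
      rw [hc]; field_simp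
    nlinarith

lemma aux_subG_sum {𝓧 : Type*} [MeasurableSpace 𝓧] (ν : Measure 𝓧) [IsProbabilityMeasure ν]
    {Ω : Type*} [MeasurableSpace Ω] (P : Measure Ω) [IsProbabilityMeasure P]
    (X : ℕ → Ω → 𝓧) (hX_meas : ∀ i, Measurable (X i))
    (hX_indep : iIndepFun (m := fun _ => ‹MeasurableSpace 𝓧›) X P)
    (hX_law : ∀ i, Measure.map (X i) P = ν)
    (g : 𝓧 → ℝ) (hg : AEMeasurable g ν) (a : ℝ) (ha : 0 < a)
    (hint : Integrable (fun x => Real.exp (a * (g x) ^ 2)) ν) (hgi : Integrable g ν)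
    (hm : ∫ x, g x ∂ν = 0) :
    ∃ c > 0, ∀ n : ℕ, 1 ≤ n → ∀ u : ℝ, 0 ≤ u →
      P {ω | u ≤ |∑ i ∈ Finset.range n, g (X i ω)|} ≤
      ENNReal.ofReal (2 * Real.exp (-c * (u ^ 2 / n))) := by
  obtain ⟨c, hc, hsub⟩ := aux_subG ν g hg a ha hint hgi hm
  have hind : iIndepFun (fun i ω => g (X i ω)) P :=
    hX_indep.comp₀ (fun _ => g) (fun i => (hX_meas i).aemeasurable)
      (fun i => by rw [hX_law i]; exact hg)
  have hind2 : iIndepFun (fun i ω => - g (X i ω)) P :=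
    hX_indep.comp₀ (fun _ x => - g x) (fun i => (hX_meas i).aemeasurable)
      (fun i => by rw [hX_law i]; exact hg.neg)
  have hs : ∀ i, HasSubgaussianMGF (fun ω => g (X i ω)) c P := fun i => by
    have : HasSubgaussianMGF g c (Measure.map (X i) P) := by rwa [hX_law i]
    constructor
    · intro t
      exact (this.integrable_exp_mul t).comp_measurable (hX_meas i)
    · intro t
      have h2 := this.mgf_le t
      rwa [mgf_map (hX_meas i).aemeasurable (this.integrable_exp_mul t).aestronglyMeasurable] at h2
  have hcr : (0:ℝ) < c := hc
  refine ⟨1 / (2 * c), by positivity, fun n hn u hu => ?_⟩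
  have hn0 : (0:ℝ) < n := by exact_mod_cast hn
  have h1 := HasSubgaussianMGF.measure_sum_range_ge_le_of_iIndepFun hind (n := n)
    (fun i _ => hs i) hu
  have h2 := HasSubgaussianMGF.measure_sum_range_ge_le_of_iIndepFun hind2 (n := n)
    (fun i _ => (hs i).neg) hu
  have he : -u ^ 2 / (2 * n * c) = -(1 / (2 * c)) * (u ^ 2 / n) := by
    field_simp
  rw [he] at h1 h2
  have hsub : {ω | u ≤ |∑ i ∈ Finset.range n, g (X i ω)|} ⊆
      {ω | u ≤ ∑ i ∈ Finset.range n, g (X i ω)} ∪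
      {ω | u ≤ ∑ i ∈ Finset.range n, - g (X i ω)} := by
    intro ω hω
    simp only [Set.mem_ofPred_eq, Set.mem_union, Finset.sum_neg_distrib] at hω ⊢
    exact le_abs.1 hω
  rw [← ofReal_measureReal]
  refine ENNReal.ofReal_le_ofReal ?_
  have h3 := measureReal_mono (μ := P) hsub
  have h4 := measureReal_union_le (μ := P) {ω | u ≤ ∑ i ∈ Finset.range n, g (X i ω)}
    {ω | u ≤ ∑ i ∈ Finset.range n, - g (X i ω)}
  linarith

/-- Exponentially negligible sequence of events. -/
def ExpNegl {Ω : Type*} [MeasurableSpace Ω] (P : Measure Ω) (A : ℕ → Set Ω) : Prop :=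
  ∃ C > 0, ∃ c > 0, ∀ n : ℕ, P (A n) ≤ ENNReal.ofReal (C * Real.exp (-c * n))

lemma ExpNegl.mono' {Ω : Type*} [MeasurableSpace Ω] {P : Measure Ω} {A A' : ℕ → Set Ω}
    (h : ExpNegl P A) (hs : ∀ n, A' n ⊆ A n) : ExpNegl P A' := by
  obtain ⟨C, hC, c, hc, h⟩ := h
  exact ⟨C, hC, c, hc, fun n => (measure_mono (hs n)).trans (h n)⟩

lemma ExpNegl.union {Ω : Type*} [MeasurableSpace Ω] {P : Measure Ω} {A A' : ℕ → Set Ω}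
    (h : ExpNegl P A) (h' : ExpNegl P A') : ExpNegl P (fun n => A n ∪ A' n) := by
  obtain ⟨C, hC, c, hc, h⟩ := h
  obtain ⟨C', hC', c', hc', h'⟩ := h'
  refine ⟨C + C', by positivity, min c c', lt_min hc hc', fun n => ?_⟩
  refine (measure_union_le _ _).trans ((add_le_add (h n) (h' n)).trans ?_)
  rw [← ENNReal.ofReal_add (by positivity) (by positivity), add_mul]
  apply ENNReal.ofReal_le_ofReal
  gcongr
  · exact min_le_left _ _
  · exact min_le_right _ _

lemma aux_core {𝓧 : Type*} [MeasurableSpace 𝓧] (ν : Measure 𝓧) [IsProbabilityMeasure ν]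
    {Ω : Type*} [MeasurableSpace Ω] (P : Measure Ω) [IsProbabilityMeasure P]
    (X : ℕ → Ω → 𝓧) (hX_meas : ∀ i, Measurable (X i))
    (hX_indep : iIndepFun (m := fun _ => ‹MeasurableSpace 𝓧›) X P)
    (hX_law : ∀ i, Measure.map (X i) P = ν)
    (K : Set ℝ) (hK : IsCompact K) (θ₀ : ℝ) (hθ₀ : θ₀ ∈ K)
    (l : ℝ → 𝓧 → ℝ) (hl : ∀ θ ∈ K, Measurable (l θ))
    (H : 𝓧 → ℝ) (hHm : Measurable H) (hH0 : ∀ x, 0 ≤ H x)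
    (hHlip : ∀ x, ∀ θ ∈ K, ∀ θ' ∈ K, |l θ x - l θ' x| ≤ H x * |θ - θ'|)
    (a : ℝ) (ha : 0 < a) (hHexp : Integrable (fun x => Real.exp (a * H x ^ 2)) ν)
    (hgap : ∀ θ ∈ K, θ ≠ θ₀ → ∫ x, (l θ x - l θ₀ x) ∂ν < 0)
    (s : 𝓧 → ℝ) (hs : AEMeasurable s ν) (hsH : ∀ᵐ x ∂ν, |s x| ≤ H x) (hs0 : ∫ x, s x ∂ν = 0)
    (J : ℝ) (hJ : 0 < J)
    (d : 𝓧 → ℝ) (hd : AEMeasurable d ν) (hd0 : ∫ x, d x ∂ν = - J)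
    (ad : ℝ) (had : 0 < ad) (hdexp : Integrable (fun x => Real.exp (ad * |d x|)) ν)
    (R : 𝓧 → ℝ) (hR : AEMeasurable R ν) (hR0 : ∀ᵐ x ∂ν, 0 ≤ R x)
    (aR : ℝ) (haR : 0 < aR) (hRexp : Integrable (fun x => Real.exp (aR * |R x|)) ν)
    (δ : ℝ) (hδ : 0 < δ)
    (hexpand : ∀ᵐ x ∂ν, ∀ θ, |θ - θ₀| < δ →
      l θ x - l θ₀ x ≤ s x * (θ - θ₀) + d x / 2 * (θ - θ₀) ^ 2 + R x * |θ - θ₀| ^ 3)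
    (θhat : ℕ → Ω → ℝ) (hmem : ∀ n ω, θhat n ω ∈ K)
    (hmax : ∀ n ω, 0 ≤ ∑ i ∈ Finset.range n, (l (θhat n ω) (X i ω) - l θ₀ (X i ω))) :
    ∃ C > 0, ∃ c > 0, ∀ n : ℕ, 1 ≤ n → ∀ t > 0,
      P {ω | t ≤ |Real.sqrt (J * n) * (θhat n ω - θ₀)|} ≤
        ENNReal.ofReal (C * Real.exp (-c * t ^ 2)) := by
  have cher : ∀ (g : 𝓧 → ℝ), AEMeasurable g ν → ∀ a' > 0,
      Integrable (fun x => Real.exp (a' * |g x|)) ν → ∀ m, ∫ x, g x ∂ν < m →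
      ExpNegl P (fun n => {ω | n * m ≤ ∑ i ∈ Finset.range n, g (X i ω)}) := by
    intro g hg a' ha' hi m hm
    obtain ⟨c, hc, h⟩ := aux_chernoff ν P X hX_meas hX_indep hX_law g hg a' ha' hi m hm
    exact ⟨1, one_pos, c, hc, fun n => by simpa using h n⟩
  have hH1 : Integrable (fun x => Real.exp (a * |H x|)) ν := by
    refine (hHexp.const_mul (Real.exp a)).mono' (by fun_prop) (ae_of_all _ fun x => ?_)
    rw [Real.norm_eq_abs, abs_of_pos (Real.exp_pos _), ← Real.exp_add]
    apply Real.exp_le_exp.2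
    rw [abs_of_nonneg (hH0 x)]
    nlinarith [sq_nonneg (H x - 1), hH0 x]
  have hHint : Integrable H ν :=
    integrable_of_mem_interior_integrableExpSet (aux_zero_mem ν H hHm.aemeasurable a ha hH1)
  have hsint : Integrable s ν := hHint.mono' hs.aestronglyMeasurable hsH
  have hs2 : Integrable (fun x => Real.exp (a * s x ^ 2)) ν := by
    have : AEMeasurable (fun x => Real.exp (a * s x ^ 2)) ν := by fun_prop
    refine hHexp.mono' this.aestronglyMeasurable ?_
    filter_upwards [hsH] with x hx
    rw [Real.norm_eq_abs, abs_of_pos (Real.exp_pos _)]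
    apply Real.exp_le_exp.2
    have : s x ^ 2 ≤ H x ^ 2 := by
      rw [← sq_abs (s x)]
      gcongr
    gcongr
  obtain ⟨cs, hcs, hS⟩ := aux_subG_sum ν P X hX_meas hX_indep hX_law s hs a ha hs2 hsint hs0
  -- the bad events
  have hE1 : ExpNegl P (fun n => {ω | n * (-J / 2) ≤ ∑ i ∈ Finset.range n, d (X i ω)}) :=
    cher d hd ad had hdexp _ (by rw [hd0]; linarith)
  set ρ := ∫ x, R x ∂ν + 1 with hρ
  have hρpos : 0 < ρ := by
    have := integral_nonneg_of_ae hR0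
    linarith
  have hE2 : ExpNegl P (fun n => {ω | n * ρ ≤ ∑ i ∈ Finset.range n, R (X i ω)}) :=
    cher R hR aR haR hRexp _ (by linarith)
  set h := ∫ x, H x ∂ν + 1 with hh
  have hhpos : 0 < h := by
    have := integral_nonneg_of_ae (μ := ν) (ae_of_all _ hH0)
    linarith
  have hE0 : ExpNegl P (fun n => {ω | n * h ≤ ∑ i ∈ Finset.range n, H (X i ω)}) :=
    cher H hHm.aemeasurable a ha hH1 _ (by linarith)
  set δ' := min δ (J / (8 * ρ)) with hδ'
  have hδ'pos : 0 < δ' := lt_min hδ (by positivity)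
  have hE3 : ExpNegl P (fun n => {ω | δ' ≤ |θhat n ω - θ₀|}) := by
    have hK' : IsCompact (K ∩ {θ | δ' ≤ |θ - θ₀|}) :=
      hK.inter_right (isClosed_le continuous_const (by fun_prop))
    have key : ExpNegl P (fun n => {ω | θhat n ω ∈ K ∩ {θ | δ' ≤ |θ - θ₀|}}) := by
      refine hK'.induction_on (p := fun S => ExpNegl P (fun n => {ω | θhat n ω ∈ S})) ?_ ?_ ?_ ?_
      · exact ⟨1, one_pos, 1, one_pos, fun n => by simp⟩
      · intro S T hST hT
        exact hT.mono' (fun n ω hω => hST hω)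
      · intro S T hS hT
        exact (hS.union hT).mono' (fun n ω hω => hω)
      · rintro θ ⟨hθK, hθ⟩
        have hθ : δ' ≤ |θ - θ₀| := hθ
        have hne : θ ≠ θ₀ := by
          rintro rfl
          simp at hθ
          linarith
        set γ := -∫ x, (l θ x - l θ₀ x) ∂ν with hγ
        have hγpos : 0 < γ := by have := hgap θ hθK hne; linarith
        have hDpos : 0 < |θ - θ₀| := by linarith
        have hml : Measurable (fun x => l θ x - l θ₀ x) := (hl θ hθK).sub (hl θ₀ hθ₀)
        have hA : ExpNegl P (fun n => {ω | n * (-γ / 2) ≤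
            ∑ i ∈ Finset.range n, (l θ (X i ω) - l θ₀ (X i ω))}) := by
          refine cher (fun x => l θ x - l θ₀ x) hml.aemeasurable (a / |θ - θ₀|) (by positivity)
            ?_ _ (by linarith)
          refine hH1.mono' (by fun_prop) (ae_of_all _ fun x => ?_)
          rw [Real.norm_eq_abs, abs_of_pos (Real.exp_pos _)]
          apply Real.exp_le_exp.2
          have h1 := hHlip x θ hθK θ₀ hθ₀
          calc a / |θ - θ₀| * |l θ x - l θ₀ x| ≤ a / |θ - θ₀| * (H x * |θ - θ₀|) := by gcongr
            _ = a * H x := by field_simp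
            _ ≤ a * |H x| := by gcongr; exact le_abs_self _
        refine ⟨Metric.ball θ (γ / (2 * h)) ∩ K, ?_, (hA.union hE0).mono' ?_⟩
        · have h1 : Metric.ball θ (γ / (2 * h)) ∈ nhds θ := Metric.ball_mem_nhds _ (by positivity)
          rw [mem_nhdsWithin_iff_exists_mem_nhds_inter]
          exact ⟨_, h1, fun y hy => ⟨hy.1, hy.2.1⟩⟩
        · intro n ω hω
          obtain ⟨hω1, hω2⟩ : θhat n ω ∈ Metric.ball θ (γ / (2 * h)) ∧ θhat n ω ∈ K := hω
          by_contra hcon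
          rw [Set.mem_union, not_or] at hcon
          obtain ⟨hc1, hc2⟩ := hcon
          simp only [Set.mem_ofPred_eq, not_le] at hc1 hc2
          have hdist : |θhat n ω - θ| < γ / (2 * h) := hω1
          have hle : ∑ i ∈ Finset.range n, (l (θhat n ω) (X i ω) - l θ₀ (X i ω)) ≤
              ∑ i ∈ Finset.range n, (l θ (X i ω) - l θ₀ (X i ω)) +
              (∑ i ∈ Finset.range n, H (X i ω)) * |θhat n ω - θ| := by
            rw [Finset.sum_mul, ← Finset.sum_add_distrib]
            apply Finset.sum_le_sum
            intro i _
            have := (abs_le.1 (hHlip (X i ω) _ hω2 θ hθK)).2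
            linarith
          have h0 := hmax n ω
          have hHs : 0 ≤ ∑ i ∈ Finset.range n, H (X i ω) := Finset.sum_nonneg fun i _ => hH0 _
          have h3 : (∑ i ∈ Finset.range n, H (X i ω)) * |θhat n ω - θ| ≤
              (n * h) * (γ / (2 * h)) := by gcongr
          have h4 : (n * h) * (γ / (2 * h)) = n * (γ / 2) := by field_simp
          linarith
    exact key.mono' (fun n ω hω => ⟨hmem n ω, hω⟩)
  obtain ⟨C, hC, c, hc, hbad⟩ := (hE1.union hE2).union hE3
  obtain ⟨b, hb0, hb⟩ : ∃ b > 0, ∀ θ ∈ K, |θ - θ₀| ≤ b := by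
    obtain ⟨r, hr⟩ := hK.isBounded.subset_closedBall θ₀
    refine ⟨max r 1, by positivity, fun θ hθ => ?_⟩
    have : |θ - θ₀| ≤ r := hr hθ
    exact this.trans (le_max_left _ _)
  refine ⟨C + 2, by positivity, min (c / (J * b ^ 2)) (cs * (J / 64)), by positivity,
    fun n hn t ht => ?_⟩
  have hn0 : (0:ℝ) < n := by exact_mod_cast hn
  have hsq : 0 < Real.sqrt (J * n) := Real.sqrt_pos.2 (by positivity)
  have hsq2 : Real.sqrt (J * n) ^ 2 = J * n := Real.sq_sqrt (by positivity)
  rcases lt_or_ge (Real.sqrt (J * n) * b) t with hbig | hsmall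
  · have : {ω | t ≤ |Real.sqrt (J * n) * (θhat n ω - θ₀)|} = ∅ := by
      ext ω
      simp only [Set.mem_ofPred_eq, Set.mem_empty_iff_false, iff_false, not_le]
      rw [abs_mul, abs_of_pos hsq]
      refine lt_of_le_of_lt ?_ hbig
      gcongr
      exact hb _ (hmem n ω)
    rw [this]
    simp
  set u := n * J / 8 * (t / Real.sqrt (J * n)) with hu
  have hu0 : 0 ≤ u := by positivity
  have hu2 : u ^ 2 / n = J / 64 * t ^ 2 := by
    rw [hu, mul_pow, div_pow t, hsq2]
    field_simp
    norm_num
  have hSn := hS n hn u hu0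
  rw [hu2] at hSn
  have hae : ∀ᵐ ω ∂P, ∀ i, 0 ≤ R (X i ω) ∧ ∀ θ, |θ - θ₀| < δ →
      l θ (X i ω) - l θ₀ (X i ω) ≤ s (X i ω) * (θ - θ₀) + d (X i ω) / 2 * (θ - θ₀) ^ 2
        + R (X i ω) * |θ - θ₀| ^ 3 := by
    rw [ae_all_iff]
    intro i
    have h1 : ∀ᵐ x ∂(Measure.map (X i) P), 0 ≤ R x ∧ ∀ θ, |θ - θ₀| < δ →
      l θ x - l θ₀ x ≤ s x * (θ - θ₀) + d x / 2 * (θ - θ₀) ^ 2 + R x * |θ - θ₀| ^ 3 := by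
      rw [hX_law i]
      exact hR0.and hexpand
    exact ae_of_ae_map (hX_meas i).aemeasurable h1
  have hsub : P {ω | t ≤ |Real.sqrt (J * n) * (θhat n ω - θ₀)|} ≤
      P ((({ω | n * (-J / 2) ≤ ∑ i ∈ Finset.range n, d (X i ω)} ∪
        {ω | n * ρ ≤ ∑ i ∈ Finset.range n, R (X i ω)}) ∪ {ω | δ' ≤ |θhat n ω - θ₀|}) ∪
        {ω | u ≤ |∑ i ∈ Finset.range n, s (X i ω)|}) := by
    apply measure_mono_ae
    filter_upwards [hae] with ω hω hmemω
    have hmemω : t ≤ |Real.sqrt (J * n) * (θhat n ω - θ₀)| := hmemω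
    by_contra hcon
    have hcon : ¬ (((n * (-J / 2) ≤ ∑ i ∈ Finset.range n, d (X i ω) ∨
        n * ρ ≤ ∑ i ∈ Finset.range n, R (X i ω)) ∨ δ' ≤ |θhat n ω - θ₀|) ∨
        u ≤ |∑ i ∈ Finset.range n, s (X i ω)|) := hcon
    push Not at hcon
    obtain ⟨⟨⟨hd1, hR1⟩, hδ1⟩, hS1⟩ := hcon
    set Δ := θhat n ω - θ₀ with hΔ
    set Sn := ∑ i ∈ Finset.range n, s (X i ω) with hSn'
    set Dn := ∑ i ∈ Finset.range n, d (X i ω) with hDn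
    set Rn := ∑ i ∈ Finset.range n, R (X i ω) with hRn
    rw [abs_mul, abs_of_pos hsq] at hmemω
    have hΔpos : 0 < |Δ| := by
      by_contra hneg
      have : |Δ| = 0 := le_antisymm (not_lt.1 hneg) (abs_nonneg _)
      rw [this] at hmemω
      linarith
    have hle : ∑ i ∈ Finset.range n, (l (θhat n ω) (X i ω) - l θ₀ (X i ω)) ≤
        Sn * Δ + Dn / 2 * Δ ^ 2 + Rn * |Δ| ^ 3 := by
      rw [hSn', hDn, hRn, Finset.sum_div, Finset.sum_mul, Finset.sum_mul, Finset.sum_mul,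
        ← Finset.sum_add_distrib, ← Finset.sum_add_distrib]
      apply Finset.sum_le_sum
      intro i _
      exact (hω i).2 _ (hδ1.trans_le (min_le_left _ _))
    have h0 := (hmax n ω).trans hle
    have hRn0 : 0 ≤ Rn := Finset.sum_nonneg fun i _ => (hω i).1
    have h1 : Rn * |Δ| ≤ n * J / 8 := by
      calc Rn * |Δ| ≤ (n * ρ) * (J / (8 * ρ)) := by
            gcongr
            exact (hδ1.trans_le (min_le_right _ _)).le
        _ = n * J / 8 := by field_simp
    have h2 : Rn * |Δ| ^ 3 ≤ n * J / 8 * |Δ| ^ 2 := by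
      have : Rn * |Δ| ^ 3 = Rn * |Δ| * |Δ| ^ 2 := by ring
      rw [this]
      gcongr
    have h3 : Dn / 2 * Δ ^ 2 ≤ -(n * J / 4) * |Δ| ^ 2 := by
      rw [sq_abs]
      apply mul_le_mul_of_nonneg_right _ (sq_nonneg _)
      linarith
    have h4 : Sn * Δ ≤ |Sn| * |Δ| := by rw [← abs_mul]; exact le_abs_self _
    have h5 : n * J / 8 * |Δ| ^ 2 ≤ |Sn| * |Δ| := by nlinarith
    have h6 : n * J / 8 * |Δ| ≤ |Sn| := by
      refine le_of_mul_le_mul_right ?_ hΔpos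
      linarith
    have h7 : u ≤ n * J / 8 * |Δ| := by
      rw [hu]
      gcongr
      rw [div_le_iff₀ hsq]
      linarith
    linarith
  refine hsub.trans ((measure_union_le _ _).trans ((add_le_add (hbad n) hSn).trans ?_))
  rw [← ENNReal.ofReal_add (by positivity) (by positivity), add_mul]
  apply ENNReal.ofReal_le_ofReal
  gcongr ?_ * Real.exp ?_ + ?_ * Real.exp ?_
  · have h1 : t ^ 2 ≤ J * n * b ^ 2 := by
      rw [← hsq2, ← mul_pow]
      gcongr
    have h2 : c / (J * b ^ 2) * t ^ 2 ≤ c * n := by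
      calc c / (J * b ^ 2) * t ^ 2 ≤ c / (J * b ^ 2) * (J * n * b ^ 2) := by gcongr
        _ = c * n := by field_simp
    have h3 : min (c / (J * b ^ 2)) (cs * (J / 64)) * t ^ 2 ≤ c / (J * b ^ 2) * t ^ 2 := by
      gcongr
      exact min_le_left _ _
    linarith
  · have h3 : min (c / (J * b ^ 2)) (cs * (J / 64)) * t ^ 2 ≤ cs * (J / 64) * t ^ 2 := by
      gcongr
      exact min_le_right _ _
    linarith

lemma aux_taylor (φ : ℝ → ℝ) (θ₀ δ M : ℝ) (hM : 0 ≤ M)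
    (h1 : ∀ θ, |θ - θ₀| < δ → DifferentiableAt ℝ φ θ)
    (h2 : ∀ θ, |θ - θ₀| < δ → DifferentiableAt ℝ (deriv φ) θ)
    (h3 : ∀ θ, |θ - θ₀| < δ → |deriv (deriv φ) θ₀ - deriv (deriv φ) θ| ≤ M * |θ - θ₀|)
    (θ : ℝ) (hθ : |θ - θ₀| < δ) :
    φ θ - φ θ₀ - deriv φ θ₀ * (θ - θ₀) - deriv (deriv φ) θ₀ / 2 * (θ - θ₀) ^ 2 ≤
      M * |θ - θ₀| ^ 3 := by
  have hball : ∀ r y, y ∈ Metric.closedBall θ₀ r ↔ |y - θ₀| ≤ r := fun r y => Iff.rfl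
  have hs1 : ∀ y, |y - θ₀| < δ →
      |deriv φ y - deriv φ θ₀ - deriv (deriv φ) θ₀ * (y - θ₀)| ≤ M * |y - θ₀| ^ 2 := by
    intro y hy
    have := Convex.norm_image_sub_le_of_norm_hasDerivWithin_le (𝕜 := ℝ)
      (f := fun z => deriv φ z - deriv φ θ₀ - deriv (deriv φ) θ₀ * (z - θ₀))
      (f' := fun z => deriv (deriv φ) z - deriv (deriv φ) θ₀)
      (s := Metric.closedBall θ₀ |y - θ₀|) (x := θ₀) (y := y) (C := M * |y - θ₀|)
      (fun z hz => by
        have hz' : |z - θ₀| < δ := lt_of_le_of_lt hz hy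
        have e1 := ((h2 z hz').hasDerivAt.sub_const (deriv φ θ₀)).sub
          (((hasDerivAt_id z).sub_const θ₀).const_mul (deriv (deriv φ) θ₀))
        simp only [mul_one] at e1
        exact e1.hasDerivWithinAt)
      (fun z hz => by
        have hz1 : |z - θ₀| ≤ |y - θ₀| := hz
        have hz' : |z - θ₀| < δ := lt_of_le_of_lt hz hy
        rw [Real.norm_eq_abs, abs_sub_comm]
        exact (h3 z hz').trans (by gcongr))
      (convex_closedBall _ _) (by simp) (by rw [hball])
    simp only [sub_self, mul_zero, sub_zero, Real.norm_eq_abs] at this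
    calc _ ≤ _ := this
      _ = _ := by ring
  have := Convex.norm_image_sub_le_of_norm_hasDerivWithin_le (𝕜 := ℝ)
      (f := fun z => φ z - φ θ₀ - deriv φ θ₀ * (z - θ₀) - deriv (deriv φ) θ₀ / 2 * (z - θ₀) ^ 2)
      (f' := fun z => deriv φ z - deriv φ θ₀ - deriv (deriv φ) θ₀ * (z - θ₀))
      (s := Metric.closedBall θ₀ |θ - θ₀|) (x := θ₀) (y := θ) (C := M * |θ - θ₀| ^ 2)
      (fun z hz => by
        have hz' : |z - θ₀| < δ := lt_of_le_of_lt hz hθ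
        have e0 := (hasDerivAt_id z).sub_const θ₀
        have e1 := (((h1 z hz').hasDerivAt.sub_const (φ θ₀)).sub
          (e0.const_mul (deriv φ θ₀))).sub ((e0.pow 2).const_mul (deriv (deriv φ) θ₀ / 2))
        refine (e1.congr_deriv ?_).hasDerivWithinAt
        simp
        ring)
      (fun z hz => by
        have hz1 : |z - θ₀| ≤ |θ - θ₀| := hz
        have hz' : |z - θ₀| < δ := lt_of_le_of_lt hz hθ
        rw [Real.norm_eq_abs]
        exact (hs1 z hz').trans (by gcongr))
      (convex_closedBall _ _) (by simp) (by rw [hball])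
  simp only [sub_self, mul_zero, sub_zero, Real.norm_eq_abs] at this
  refine (le_abs_self _).trans ?_
  norm_num at this
  calc _ ≤ _ := this
    _ = _ := by rw [← sq_abs (θ - θ₀)]; ring

lemma aux_lip_env {𝓧 : Type*} [MeasurableSpace 𝓧] (Θ : Set ℝ) (hΘ : IsOpen Θ)
    (l : ℝ → 𝓧 → ℝ) (hl : ∀ θ ∈ closure Θ, Measurable (l θ)) (H : 𝓧 → ℝ) (hH0 : ∀ x, 0 ≤ H x)
    (hlip : ∀ x, ∀ θ ∈ closure Θ, ∀ θ' ∈ closure Θ, |l θ x - l θ' x| ≤ H x * |θ - θ'|) :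
    ∃ G : 𝓧 → ℝ, Measurable G ∧ (∀ x, 0 ≤ G x) ∧ (∀ x, G x ≤ H x) ∧
      ∀ x, ∀ θ ∈ closure Θ, ∀ θ' ∈ closure Θ, |l θ x - l θ' x| ≤ G x * |θ - θ'| := by
  classical
  set F : ℚ × ℚ → 𝓧 → ℝ := fun p x =>
    if (p.1 : ℝ) ∈ Θ ∧ (p.2 : ℝ) ∈ Θ then |l p.1 x - l p.2 x| / |(p.1 : ℝ) - p.2| else 0 with hF
  have hF0 : ∀ p x, 0 ≤ F p x := by
    intro p x
    simp only [hF]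
    split_ifs <;> positivity
  have hFH : ∀ p x, F p x ≤ H x := by
    intro p x
    simp only [hF]
    split_ifs with h
    · exact div_le_of_le_mul₀ (abs_nonneg _) (hH0 x)
        (hlip x _ (subset_closure h.1) _ (subset_closure h.2))
    · exact hH0 x
  have hbdd : ∀ x, BddAbove (Set.range fun p => F p x) := fun x =>
    ⟨H x, by rintro _ ⟨p, rfl⟩; exact hFH p x⟩
  refine ⟨fun x => ⨆ p, F p x, ?_, ?_, ?_, ?_⟩
  · apply Measurable.iSup
    intro p
    simp only [hF]
    by_cases h : (p.1 : ℝ) ∈ Θ ∧ (p.2 : ℝ) ∈ Θ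
    · simp only [h, and_self, if_true]
      have m1 := hl _ (subset_closure h.1)
      have m2 := hl _ (subset_closure h.2)
      fun_prop
    · simp only [h, if_false]
      fun_prop
  · exact fun x => Real.iSup_nonneg fun p => hF0 p x
  · exact fun x => ciSup_le fun p => hFH p x
  · intro x
    set G := ⨆ p, F p x with hG
    have hrat : ∀ q q' : ℚ, (q : ℝ) ∈ Θ → (q' : ℝ) ∈ Θ →
        |l q x - l q' x| ≤ G * |(q : ℝ) - q'| := by
      intro q q' hq hq'
      rcases eq_or_ne q q' with rfl | hne
      · simp
      · have h1 : F (q, q') x ≤ G := le_ciSup (hbdd x) (q, q')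
        simp only [hF, hq, hq', and_self, if_true] at h1
        have : 0 < |(q : ℝ) - q'| := abs_pos.2 (sub_ne_zero.2 (by exact_mod_cast hne))
        rwa [div_le_iff₀ this] at h1
    have hcont : ContinuousOn (fun θ => l θ x) (closure Θ) := by
      have : LipschitzOnWith ⟨H x, hH0 x⟩ (fun θ => l θ x) (closure Θ) := by
        apply LipschitzOnWith.of_dist_le_mul
        intro θ hθ θ' hθ'
        exact hlip x θ hθ θ' hθ'
      exact this.continuousOn
    set Q : Set ℝ := Θ ∩ Set.range ((↑) : ℚ → ℝ) with hQ
    have hQK : Q ⊆ closure Θ := fun y hy => subset_closure hy.1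
    have hcl : closure Θ ⊆ closure Q :=
      closure_minimal (Rat.denseRange_cast.open_subset_closure_inter hΘ) isClosed_closure
    have step1 : ∀ θ' ∈ Q, ∀ θ ∈ closure Θ, |l θ x - l θ' x| ≤ G * |θ - θ'| := by
      rintro θ' ⟨hθ', q', rfl⟩ θ hθ
      have hcQ : ContinuousWithinAt (fun θ => l θ x) Q θ := (hcont θ hθ).mono hQK
      refine ContinuousWithinAt.closure_le (hcl hθ) (f := fun θ => |l θ x - l q' x|)
        (g := fun θ => G * |θ - q'|) (hcQ.sub continuousWithinAt_const).abs
        (by fun_prop) ?_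
      rintro y ⟨hy, q, rfl⟩
      exact hrat q q' hy hθ'
    intro θ hθ θ' hθ'
    have hcQ : ContinuousWithinAt (fun θ => l θ x) Q θ' := (hcont θ' hθ').mono hQK
    refine ContinuousWithinAt.closure_le (hcl hθ') (f := fun θ' => |l θ x - l θ' x|)
        (g := fun θ' => G * |θ - θ'|) (continuousWithinAt_const.sub hcQ).abs
        (by fun_prop) ?_
    intro y hy
    exact step1 y hy θ hθ

lemma aux_rem_env {𝓧 : Type*} [MeasurableSpace 𝓧] (ν : Measure 𝓧) (θ₀ δ : ℝ) (hδ : 0 < δ)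
    (l : ℝ → 𝓧 → ℝ) (hl : ∀ θ, |θ - θ₀| < δ → Measurable (l θ))
    (hcont : ∀ x, ContinuousOn (fun θ => l θ x) (Metric.ball θ₀ δ))
    (s d : 𝓧 → ℝ) (hs : AEMeasurable s ν) (hd : AEMeasurable d ν)
    (M : 𝓧 → ℝ) (hM0 : ∀ x, 0 ≤ M x)
    (hbound : ∀ᵐ x ∂ν, ∀ θ, |θ - θ₀| < δ →
      l θ x - l θ₀ x - s x * (θ - θ₀) - d x / 2 * (θ - θ₀) ^ 2 ≤ M x * |θ - θ₀| ^ 3) :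
    ∃ R : 𝓧 → ℝ, AEMeasurable R ν ∧ ∀ᵐ x ∂ν, 0 ≤ R x ∧ R x ≤ M x ∧ ∀ θ, |θ - θ₀| < δ →
      l θ x - l θ₀ x ≤ s x * (θ - θ₀) + d x / 2 * (θ - θ₀) ^ 2 + R x * |θ - θ₀| ^ 3 := by
  classical
  set E : ℝ → 𝓧 → ℝ := fun θ x =>
    l θ x - l θ₀ x - s x * (θ - θ₀) - d x / 2 * (θ - θ₀) ^ 2 with hE
  set F : ℚ → 𝓧 → ℝ := fun q x =>
    if |(q : ℝ) - θ₀| < δ then max (E q x / |(q : ℝ) - θ₀| ^ 3) 0 else 0 with hF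
  refine ⟨fun x => ⨆ q, F q x, ?_, ?_⟩
  · apply AEMeasurable.iSup
    intro q
    simp only [hF]
    by_cases h : |(q : ℝ) - θ₀| < δ
    · simp only [h, if_true, hE]
      have m1 := (hl _ h).aemeasurable (μ := ν)
      have m2 := (hl θ₀ (by simpa using hδ)).aemeasurable (μ := ν)
      fun_prop
    · simp only [h, if_false]
      fun_prop
  · filter_upwards [hbound] with x hx
    have hF0 : ∀ q, 0 ≤ F q x := by
      intro q
      simp only [hF]
      split_ifs
      · exact le_max_right _ _
      · exact le_rfl
    have hFM : ∀ q, F q x ≤ M x := by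
      intro q
      simp only [hF]
      split_ifs with h
      · exact max_le (div_le_of_le_mul₀ (by positivity) (hM0 x) (hx q h)) (hM0 x)
      · exact hM0 x
    have hbdd : BddAbove (Set.range fun q => F q x) :=
      ⟨M x, by rintro _ ⟨p, rfl⟩; exact hFM p⟩
    refine ⟨Real.iSup_nonneg hF0, ciSup_le hFM, ?_⟩
    set R := ⨆ q, F q x with hR
    have hrat : ∀ q : ℚ, |(q : ℝ) - θ₀| < δ → E q x ≤ R * |(q : ℝ) - θ₀| ^ 3 := by
      intro q hq
      rcases eq_or_ne (q : ℝ) θ₀ with h | hne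
      · simp [hE, h]
      · have h1 : F q x ≤ R := le_ciSup hbdd q
        simp only [hF, hq, if_true] at h1
        have : 0 < |(q : ℝ) - θ₀| ^ 3 := by
          have := abs_pos.2 (sub_ne_zero.2 hne)
          positivity
        rw [← div_le_iff₀ this]
        exact (le_max_left _ _).trans h1
    intro θ hθ
    have hmem : θ ∈ closure (Metric.ball θ₀ δ ∩ Set.range ((↑) : ℚ → ℝ)) :=
      Rat.denseRange_cast.open_subset_closure_inter Metric.isOpen_ball hθ
    have hc : ContinuousWithinAt (fun θ => l θ x)
        (Metric.ball θ₀ δ ∩ Set.range ((↑) : ℚ → ℝ)) θ :=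
      ((hcont x) θ hθ).mono Set.inter_subset_left
    have : E θ x ≤ R * |θ - θ₀| ^ 3 := by
      refine ContinuousWithinAt.closure_le hmem (f := fun θ => E θ x)
        (g := fun θ => R * |θ - θ₀| ^ 3) ?_ (by fun_prop) ?_
      · simp only [hE]
        fun_prop
      · rintro y ⟨hy, q, rfl⟩
        exact hrat q hy
    simp only [hE] at this
    linarith

theorem stmt1
    -- the sample space with a σ-finite base measure
    {𝓧 : Type*} [MeasurableSpace 𝓧] (μ : Measure 𝓧) [SigmaFinite μ]
    -- the parameter set: open, with compact closure K bounded by B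
    (Θ : Set ℝ) (hΘopen : IsOpen Θ) (K : Set ℝ) (hK : K = closure Θ)
    (hKcpt : IsCompact K) (B : ℝ) (hB : ∀ θ ∈ K, |θ| ≤ B)
    -- the statistical model: positive densities, measurable, integrating to one
    (f : ℝ → 𝓧 → ℝ)
    (hf_pos : ∀ θ ∈ K, ∀ x, 0 < f θ x)
    (hf_meas : ∀ θ ∈ K, Measurable (f θ))
    (hf_prob : ∀ θ ∈ K, ∫ x, f θ x ∂μ = 1)
    -- a.e. smoothness: θ ↦ log f(x|θ) is twice differentiable on Θ, continuous on K
    (hf_smooth : ∀ᵐ x ∂μ,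
      (∀ θ ∈ Θ, DifferentiableAt ℝ (fun t => Real.log (f t x)) θ) ∧
      (∀ θ ∈ Θ, DifferentiableAt ℝ (deriv (fun t => Real.log (f t x))) θ) ∧
      ContinuousOn (fun t => Real.log (f t x)) K)
    -- identifiability
    (hident : ∀ θ ∈ K, ∀ θ' ∈ K, f θ =ᵐ[μ] f θ' → θ = θ')
    -- the true parameter
    (θ₀ : ℝ) (hθ₀ : θ₀ ∈ Θ)
    -- the score function
    (s : ℝ → 𝓧 → ℝ) (hs : ∀ θ x, s θ x = deriv (fun t => Real.log (f t x)) θ)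
    -- the Fisher information at θ₀: finite and strictly positive
    (IFi : ℝ) (hIFi_int : Integrable (fun x => deriv (fun t => s t x) θ₀ * f θ₀ x) μ)
    (hIFi : IFi = -∫ x, deriv (fun t => s t x) θ₀ * f θ₀ x ∂μ) (hIFi_pos : 0 < IFi)
    -- the i.i.d. samples X₁, X₂, … with density f(·|θ₀)
    {Ω : Type*} [MeasurableSpace Ω] (P : Measure Ω) [IsProbabilityMeasure P]
    (X : ℕ → Ω → 𝓧) (hX_meas : ∀ i, Measurable (X i))
    (hX_indep : iIndepFun (m := fun _ => ‹MeasurableSpace 𝓧›) X P)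
    (hX_law : ∀ i, Measure.map (X i) P = μ.withDensity (fun x => ENNReal.ofReal (f θ₀ x)))
    -- the maximum likelihood estimator θ̂ₙ, a measurable maximizer of Lₙ over K
    (θhat : ℕ → Ω → ℝ) (hθhat_meas : ∀ n, Measurable (θhat n))
    (hθhat_mem : ∀ (n : ℕ) (ω : Ω), θhat n ω ∈ K)
    (hθhat_max : ∀ (n : ℕ) (ω : Ω), ∀ θ ∈ K,
      (1 / (n : ℝ)) * ∑ i ∈ Finset.range n, Real.log (f θ (X i ω)) ≤
      (1 / (n : ℝ)) * ∑ i ∈ Finset.range n, Real.log (f (θhat n ω) (X i ω)))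
    -- Assumption 1: sub-Gaussian Lipschitz envelope for the log-likelihood
    (H : 𝓧 → ℝ) (hH_nonneg : ∀ x, 0 ≤ H x)
    (hH_lip : ∀ x, ∀ θ ∈ K, ∀ θ' ∈ K,
      |Real.log (f θ x) - Real.log (f θ' x)| ≤ H x * |θ - θ'|)
    (hH_subG : SubGaussianTail P (fun ω => H (X 0 ω)))
    -- Assumption 2: sub-exponential control of the score derivative
    (Hbar : 𝓧 → ℝ) (hHbar_nonneg : ∀ x, 0 ≤ Hbar x)
    (hHbar_lip : ∀ x, ∀ θ ∈ K,
      |deriv (fun t => s t x) θ₀ - deriv (fun t => s t x) θ| ≤ Hbar x * |θ - θ₀|)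
    (hscore_subE : SubExponentialTail P (fun ω => deriv (fun t => s t (X 0 ω)) θ₀))
    (hHbar_subE : SubExponentialTail P (fun ω => Hbar (X 0 ω)))
    -- the normalized estimation error
    (Z : ℕ → Ω → ℝ)
    (hZ : ∀ (n : ℕ) (ω : Ω), Z n ω = Real.sqrt (IFi * n) * (θhat n ω - θ₀)) :
    -- STATEMENT: Z_n is uniformly sub-Gaussian
    ∃ C > 0, ∃ c > 0, ∀ n : ℕ, 1 ≤ n → ∀ t > 0,
      P {ω | t ≤ |Z n ω|} ≤ ENNReal.ofReal (C * Real.exp (-c * t ^ 2)) := by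
  subst hK
  have hθK : θ₀ ∈ closure Θ := subset_closure hθ₀
  obtain ⟨δ, hδ, hball⟩ := Metric.isOpen_iff.1 hΘopen θ₀ hθ₀
  have hball' : ∀ θ, |θ - θ₀| < δ → θ ∈ Θ := fun θ hθ => hball hθ
  set l : ℝ → 𝓧 → ℝ := fun θ x => Real.log (f θ x) with hl
  set ν : Measure 𝓧 := μ.withDensity (fun x => ENNReal.ofReal (f θ₀ x)) with hν
  have hνprob : IsProbabilityMeasure ν := by
    rw [← hX_law 0]
    exact Measure.isProbabilityMeasure_map (hX_meas 0).aemeasurable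
  have hfm0 := hf_meas θ₀ hθK
  have hfint : ∀ θ ∈ closure Θ, Integrable (f θ) μ := fun θ hθ => by
    by_contra hcon
    have := hf_prob θ hθ
    rw [integral_undef hcon] at this
    exact zero_ne_one this
  have hνμ : ν ≪ μ := withDensity_absolutelyContinuous _ _
  have hμν : μ ≪ ν := withDensity_absolutelyContinuous'
    (hfm0.ennreal_ofReal.aemeasurable)
    (ae_of_all _ fun x => by simpa using hf_pos θ₀ hθK x)
  have hνint : ∀ g : 𝓧 → ℝ, ∫ x, g x ∂ν = ∫ x, g x * f θ₀ x ∂μ := fun g => by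
    rw [hν, integral_withDensity_eq_integral_toReal_smul hfm0.ennreal_ofReal
      (ae_of_all _ fun x => ENNReal.ofReal_lt_top)]
    congr 1
    ext x
    rw [ENNReal.toReal_ofReal (hf_pos θ₀ hθK x).le, smul_eq_mul, mul_comm]
  have hνintble : ∀ g : 𝓧 → ℝ, Integrable g ν ↔ Integrable (fun x => g x * f θ₀ x) μ := fun g => by
    rw [hν, integrable_withDensity_iff hfm0.ennreal_ofReal
      (ae_of_all _ fun x => ENNReal.ofReal_lt_top)]
    have : (fun x => g x * (ENNReal.ofReal (f θ₀ x)).toReal) = fun x => g x * f θ₀ x := by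
      ext x
      rw [ENNReal.toReal_ofReal (hf_pos θ₀ hθK x).le]
    rw [this]
  have hlm : ∀ θ ∈ closure Θ, Measurable (l θ) := fun θ hθ => (hf_meas θ hθ).log
  -- exponential moments, transferred to the law of the observations
  have hmoment : ∀ g : 𝓧 → ℝ, AEMeasurable g ν → SubExponentialTail P (fun ω => g (X 0 ω)) →
      ∃ a > 0, Integrable (fun x => Real.exp (a * |g x|)) ν := by
    intro g hg ht
    have hg' : AEMeasurable g (Measure.map (X 0) P) := by rwa [hX_law 0]
    obtain ⟨a, ha, hi⟩ := aux_exp_moment P (fun ω => g (X 0 ω))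
      (hg'.comp_measurable (hX_meas 0)) ht
    refine ⟨a, ha, ?_⟩
    rw [← hX_law 0, integrable_map_measure _ (hX_meas 0).aemeasurable]
    · exact hi
    · have : AEMeasurable (fun x => Real.exp (a * |g x|)) (Measure.map (X 0) P) := by fun_prop
      exact this.aestronglyMeasurable
  -- measurable Lipschitz envelope
  obtain ⟨G, hGm, hG0, hGH, hGlip⟩ := aux_lip_env Θ hΘopen l hlm H hH_nonneg hH_lip
  obtain ⟨a, ha, hGexp⟩ : ∃ a > 0, Integrable (fun x => Real.exp (a * G x ^ 2)) ν := by
    obtain ⟨a, ha, hi⟩ := hmoment (fun x => G x ^ 2) (by fun_prop) (by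
      obtain ⟨C, hC, c, hc, h⟩ := hH_subG
      refine ⟨C, hC, c, hc, fun t ht => ?_⟩
      have h1 := h (Real.sqrt t) (Real.sqrt_pos.2 ht)
      rw [Real.sq_sqrt ht.le] at h1
      refine (measure_mono ?_).trans h1
      intro ω hω
      have hω : t ≤ |G (X 0 ω) ^ 2| := hω
      show Real.sqrt t ≤ |H (X 0 ω)|
      rw [abs_of_nonneg (sq_nonneg _)] at hω
      rw [abs_of_nonneg (hH_nonneg _)]
      exact ((Real.sqrt_le_left (hG0 _)).2 hω).trans (hGH _))
    refine ⟨a, ha, hi.congr (ae_of_all _ fun x => ?_)⟩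
    simp only [abs_of_nonneg (sq_nonneg (G x))]
  have hG1 : Integrable (fun x => Real.exp (a * |G x|)) ν := by
    refine (hGexp.const_mul (Real.exp a)).mono' (by fun_prop) (ae_of_all _ fun x => ?_)
    rw [Real.norm_eq_abs, abs_of_pos (Real.exp_pos _), ← Real.exp_add]
    apply Real.exp_le_exp.2
    rw [abs_of_nonneg (hG0 x)]
    nlinarith [sq_nonneg (G x - 1), hG0 x]
  have hGint : Integrable G ν :=
    integrable_of_mem_interior_integrableExpSet (aux_zero_mem ν G hGm.aemeasurable a ha hG1)
  have hldint : ∀ θ ∈ closure Θ, Integrable (fun x => l θ x - l θ₀ x) ν := fun θ hθ => by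
    have := (hlm θ hθ).sub (hlm θ₀ hθK)
    exact (hGint.mul_const |θ - θ₀|).mono' this.aestronglyMeasurable
      (ae_of_all _ fun x => hGlip x θ hθ θ₀ hθK)
  -- Kullback-Leibler gap
  have hratio : ∀ θ ∈ closure Θ, Integrable (fun x => f θ x / f θ₀ x - 1) ν ∧
      ∫ x, (f θ x / f θ₀ x - 1) ∂ν = 0 := fun θ hθ => by
    have he : (fun x => (f θ x / f θ₀ x - 1) * f θ₀ x) = fun x => f θ x - f θ₀ x := by
      ext x
      have := (hf_pos θ₀ hθK x).ne'
      field_simp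
    rw [hνintble, hνint, he]
    refine ⟨(hfint θ hθ).sub (hfint θ₀ hθK), ?_⟩
    rw [integral_sub (hfint θ hθ) (hfint θ₀ hθK), hf_prob θ hθ, hf_prob θ₀ hθK, sub_self]
  have hlogle : ∀ θ ∈ closure Θ, ∀ x, l θ x - l θ₀ x ≤ f θ x / f θ₀ x - 1 := fun θ hθ x => by
    simp only [hl]
    rw [← Real.log_div (hf_pos θ hθ x).ne' (hf_pos θ₀ hθK x).ne']
    exact Real.log_le_sub_one_of_pos (div_pos (hf_pos θ hθ x) (hf_pos θ₀ hθK x))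
  have hKL : ∀ θ ∈ closure Θ, ∫ x, (l θ x - l θ₀ x) ∂ν ≤ 0 := fun θ hθ => by
    rw [← (hratio θ hθ).2]
    exact integral_mono (hldint θ hθ) (hratio θ hθ).1 (hlogle θ hθ)
  have hgap : ∀ θ ∈ closure Θ, θ ≠ θ₀ → ∫ x, (l θ x - l θ₀ x) ∂ν < 0 := by
    intro θ hθ hne
    refine lt_of_le_of_ne (hKL θ hθ) fun h0 => hne ?_
    apply hident θ hθ θ₀ hθK
    have h1 : ∫ x, ((f θ x / f θ₀ x - 1) - (l θ x - l θ₀ x)) ∂ν = 0 := by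
      rw [integral_sub (hratio θ hθ).1 (hldint θ hθ), h0, (hratio θ hθ).2, sub_self]
    rw [integral_eq_zero_iff_of_nonneg (fun x => sub_nonneg.2 (hlogle θ hθ x))
      ((hratio θ hθ).1.sub (hldint θ hθ))] at h1
    refine hμν.ae_le ?_
    filter_upwards [h1] with x hx
    have hx : (f θ x / f θ₀ x - 1) - (l θ x - l θ₀ x) = 0 := hx
    have hp := hf_pos θ₀ hθK x
    have hp' := hf_pos θ hθ x
    by_contra hcon
    have h2 := Real.log_lt_sub_one_of_pos (div_pos hp' hp) (fun h => hcon (by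
      rwa [div_eq_one_iff_eq hp.ne'] at h))
    rw [Real.log_div hp'.ne' hp.ne'] at h2
    simp only [hl] at hx
    linarith
  -- the score
  have hsmooth := hνμ.ae_le hf_smooth
  have hderiv : ∀ᵐ x ∂ν, HasDerivAt (fun t => l t x) (s θ₀ x) θ₀ := by
    filter_upwards [hsmooth] with x hx
    rw [hs]
    exact (hx.1 θ₀ hθ₀).hasDerivAt
  have hsm : AEMeasurable (s θ₀) ν := by
    set u : ℕ → ℝ := fun n => θ₀ + δ / (n + 2) with hu
    have hu1 : ∀ n, |u n - θ₀| < δ := fun n => by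
      simp only [hu, add_sub_cancel_left]
      rw [abs_of_pos (by positivity), div_lt_iff₀ (by positivity)]
      have : (0:ℝ) ≤ n := by positivity
      nlinarith
    have hune : ∀ n, u n ≠ θ₀ := fun n => by
      have : 0 < δ / ((n:ℝ) + 2) := by positivity
      simp only [hu]
      intro h
      linarith
    have hut : Tendsto u atTop (nhds θ₀) := by
      have h1 : Tendsto (fun n : ℕ => ((n:ℝ) + 2)) atTop atTop :=
        tendsto_atTop_add_const_right _ _ tendsto_natCast_atTop_atTop
      have h2 := (h1.const_div_atTop δ).const_add θ₀
      simpa [hu] using h2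
    refine aemeasurable_of_tendsto_metrizable_ae atTop
      (f := fun n x => slope (fun t => l t x) θ₀ (u n)) ?_ ?_
    · intro n
      simp only [slope_def_field]
      have m1 := hlm (u n) (subset_closure (hball' _ (hu1 n)))
      have m2 := hlm θ₀ hθK
      fun_prop
    · filter_upwards [hderiv] with x hx
      exact (hasDerivAt_iff_tendsto_slope.1 hx).comp
        (tendsto_nhdsWithin_iff.2 ⟨hut, Eventually.of_forall hune⟩)
  have hnhds : Metric.ball θ₀ δ ∈ nhds θ₀ := Metric.ball_mem_nhds _ hδ
  have hballK : ∀ θ ∈ Metric.ball θ₀ δ, θ ∈ closure Θ := fun θ hθ => subset_closure (hball hθ)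
  have hsG : ∀ᵐ x ∂ν, |s θ₀ x| ≤ G x := by
    filter_upwards [hderiv] with x hx
    refine hx.le_of_lip' (hG0 x) ?_
    filter_upwards [hnhds] with θ hθ
    exact hGlip x θ (hballK θ hθ) θ₀ hθK
  have hs0 : ∫ x, s θ₀ x ∂ν = 0 := by
    have h1 := (hasDerivAt_integral_of_dominated_loc_of_lip (μ := ν) (𝕜 := ℝ)
      (F := fun θ x => l θ x - l θ₀ x) (F' := s θ₀) (bound := G) (x₀ := θ₀) hnhds
      (by
        filter_upwards [hnhds] with θ hθ
        exact (hldint θ (hballK θ hθ)).aestronglyMeasurable)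
      (hldint θ₀ hθK) hsm.aestronglyMeasurable
      (ae_of_all _ fun x => by
        apply LipschitzOnWith.of_dist_le_mul
        intro θ hθ θ' hθ'
        have := hGlip x θ (hballK θ hθ) θ' (hballK θ' hθ')
        rw [Real.dist_eq, Real.dist_eq, Real.coe_nnabs, abs_of_nonneg (hG0 x)]
        simpa using this)
      hGint
      (by
        filter_upwards [hderiv] with x hx
        exact hx.sub_const _)).2
    refine IsLocalMax.hasDerivAt_eq_zero ?_ h1
    filter_upwards [hnhds] with θ hθ
    simpa using hKL θ (hballK θ hθ)
  -- the derivative of the score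
  set d : 𝓧 → ℝ := fun x => deriv (fun t => s t x) θ₀ with hd
  have hdm : AEMeasurable d ν := by
    have h1 : AEMeasurable (fun x => d x * f θ₀ x) μ := hIFi_int.aestronglyMeasurable.aemeasurable
    have h2 : AEMeasurable (fun x => d x * f θ₀ x / f θ₀ x) μ := h1.div hfm0.aemeasurable
    have h3 : (fun x => d x * f θ₀ x / f θ₀ x) = d := by
      ext x
      exact mul_div_cancel_right₀ _ (hf_pos θ₀ hθK x).ne'
    rw [h3] at h2
    exact h2.mono_ac hνμ
  have hd0 : ∫ x, d x ∂ν = -IFi := by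
    rw [hνint, hIFi, neg_neg]
  obtain ⟨ad, had, hdexp⟩ := hmoment d hdm hscore_subE
  -- the remainder
  have hsfun : ∀ x, (fun t => s t x) = deriv (fun t => l t x) := fun x => by
    ext t
    exact hs t x
  have hcontball : ∀ x, ContinuousOn (fun θ => l θ x) (Metric.ball θ₀ δ) := fun x => by
    have : LipschitzOnWith ⟨G x, hG0 x⟩ (fun θ => l θ x) (Metric.ball θ₀ δ) := by
      apply LipschitzOnWith.of_dist_le_mul
      intro θ hθ θ' hθ'
      exact hGlip x θ (hballK θ hθ) θ' (hballK θ' hθ')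
    exact this.continuousOn
  obtain ⟨R, hRm, hRae⟩ := aux_rem_env ν θ₀ δ hδ l
    (fun θ hθ => hlm θ (hballK θ hθ)) hcontball (s θ₀) d hsm hdm Hbar hHbar_nonneg (by
      filter_upwards [hsmooth] with x hx θ hθ
      have h1 := aux_taylor (fun t => l t x) θ₀ δ (Hbar x) (hHbar_nonneg x)
        (fun y hy => hx.1 y (hball' y hy)) (fun y hy => hx.2.1 y (hball' y hy))
        (fun y hy => by
          have := hHbar_lip x y (hballK y hy)
          rwa [hsfun x] at this) θ hθ
      rw [hs θ₀ x]
      simp only [hd, hsfun x]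
      exact h1)
  obtain ⟨aR, haR, hRexp⟩ := hmoment R hRm (by
    obtain ⟨C, hC, c, hc, h⟩ := hHbar_subE
    refine ⟨C, hC, c, hc, fun t ht => (measure_mono_ae ?_).trans (h t ht)⟩
    have h1 : ∀ᵐ ω ∂P, 0 ≤ R (X 0 ω) ∧ R (X 0 ω) ≤ Hbar (X 0 ω) := by
      apply ae_of_ae_map (hX_meas 0).aemeasurable (p := fun x => 0 ≤ R x ∧ R x ≤ Hbar x)
      rw [hX_law 0]
      filter_upwards [hRae] with x hx using ⟨hx.1, hx.2.1⟩
    filter_upwards [h1] with ω hω hmem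
    have hmem : t ≤ |R (X 0 ω)| := hmem
    show t ≤ |Hbar (X 0 ω)|
    rw [abs_of_nonneg hω.1] at hmem
    rw [abs_of_nonneg (hHbar_nonneg _)]
    exact hmem.trans hω.2)
  have hfinal := aux_core ν P X hX_meas hX_indep hX_law (closure Θ) hKcpt θ₀ hθK l hlm G hGm hG0
    hGlip a ha hGexp hgap (s θ₀) hsm hsG hs0 IFi hIFi_pos d hdm hd0 ad had hdexp R hRm
    (hRae.mono fun x hx => hx.1) aR haR hRexp δ hδ (hRae.mono fun x hx => hx.2.2) θhat hθhat_mem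
    (fun n ω => by
      rcases Nat.eq_zero_or_pos n with rfl | hn
      · simp
      · have h1 := hθhat_max n ω θ₀ hθK
        have hn0 : (0:ℝ) < 1 / (n:ℝ) := by positivity
        rw [Finset.sum_sub_distrib, sub_nonneg]
        exact le_of_mul_le_mul_left h1 hn0)
  simp only [hZ]
  exact hfinal
end
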